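/- arXiv:2012.12985 — 3 statements merged into one kernel-verified Lean document; each statement's English description precedes it below -/
import Mathlib

section
/- Let A be a commutative ring, φ : E_1 → E_2 a map of A-modules with E_1 free of finite rank such that φ is injective with flat cokernel. For n ≥ 0 let Kos(φ, n) be the complex with Kos(φ,n)^q = Γ_{n-q}(E_1) ⊗_A ⋀^q E_2 and differential e_1^{[i_1]}⋯e_k^{[i_k]} ⊗ f ↦ Σ_j e_1^{[i_1]}⋯e_j^{[i_j-1]}⋯e_k^{[i_k]} ⊗ φ(e_j) ∧ f. Then H^q(Kos(φ,n)) = 0 for q ≠ n and H^n(Kos(φ,n)) ≅ ⋀^n coker(φ). -/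
open ExteriorAlgebra TensorProduct

variable (R : Type*) [CommRing R] (M : Type*) [AddCommGroup M] [Module R M]

/-- The wedge product `⋀^p M ⊗ ⋀^q M → ⋀^{p+q} M`. -/
noncomputable def wedgeMul (p q : ℕ) : ⋀[R]^p M →ₗ[R] ⋀[R]^q M →ₗ[R] ⋀[R]^(p+q) M where
  toFun x :=
    { toFun := fun y => ⟨(x : ExteriorAlgebra R M) * (y : ExteriorAlgebra R M), by
        show _ ∈ LinearMap.range (ι R (M := M)) ^ (p + q)
        rw [pow_add]; exact Submodule.mul_mem_mul x.2 y.2⟩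
      map_add' := fun y z => by ext : 1; simp [mul_add]
      map_smul' := fun c y => by ext : 1; simp [Algebra.mul_smul_comm] }
  map_add' := fun x z => by ext y : 2; simp [add_mul]
  map_smul' := fun c x => by ext y : 2; simp [Algebra.smul_mul_assoc]

variable {M}

/-- `ι x` as an element of `⋀^1 M`. -/
noncomputable def expOne (x : M) : ⋀[R]^1 M :=
  ⟨ι R x, by
    show _ ∈ LinearMap.range (ι R (M := M)) ^ 1
    rw [pow_one]; exact LinearMap.mem_range_self _ x⟩

/-- Left wedge multiplication by `x : M`, as a map `⋀^q M → ⋀^{q+1} M`. -/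
noncomputable def wedgeBy (x : M) (q : ℕ) : ⋀[R]^q M →ₗ[R] ⋀[R]^(q+1) M :=
  (Submodule.inclusion (le_of_eq (by rw [Nat.add_comm]))).comp
    (wedgeMul R M 1 q (expOne R x))

variable {N : Type*} [AddCommGroup N] [Module R N]

/-- The map `⋀^q M → ⋀^q N` induced by a linear map `M → N`. -/
noncomputable def expMap (f : M →ₗ[R] N) (q : ℕ) : ⋀[R]^q M →ₗ[R] ⋀[R]^q N :=
  (ExteriorAlgebra.map f).toLinearMap.restrict (p := ⋀[R]^q M) (q := ⋀[R]^q N)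
    (fun x hx => by
      have h1 : Submodule.map (ExteriorAlgebra.map f).toLinearMap
          (LinearMap.range (ι R (M := M)) ^ q) ≤ LinearMap.range (ι R (M := N)) ^ q := by
        rw [Submodule.map_pow]
        refine pow_le_pow_left' ?_ q
        rw [ι_range_map_map]
        exact LinearMap.map_le_range
      exact h1 ⟨x, hx, rfl⟩)

/-- The total degree of a multi-index. -/
def degSum {r : ℕ} (a : Fin r →₀ ℕ) : ℕ := a.sum fun _ v => v

/-- The degree-`k` part `Γ_k(A^r)` of the divided power algebra on a free module of
rank `r`: the free module on the divided-power monomials `e^{[a]}` with `|a| = k`. -/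
def Gamma (A : Type*) [CommRing A] (r k : ℕ) : Type _ :=
  {a : Fin r →₀ ℕ // degSum a = k} →₀ A

noncomputable instance (A : Type*) [CommRing A] (r k : ℕ) : AddCommGroup (Gamma A r k) :=
  inferInstanceAs (AddCommGroup ({a : Fin r →₀ ℕ // degSum a = k} →₀ A))

noncomputable instance (A : Type*) [CommRing A] (r k : ℕ) : Module A (Gamma A r k) :=
  inferInstanceAs (Module A ({a : Fin r →₀ ℕ // degSum a = k} →₀ A))

namespace KosAux
open ExteriorAlgebra TensorProduct

variable {A : Type*} [CommRing A] {E : Type*} [AddCommGroup E] [Module A E]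

theorem ι_mul_eq (x v : E) (w : ExteriorAlgebra A E) :
    ι A v * (ι A x * w) = - (ι A x * (ι A v * w)) := by
  have h := ι_add_mul_swap (R := A) v x
  rw [← mul_assoc, ← mul_assoc, eq_neg_iff_add_eq_zero, ← add_mul, h, zero_mul]

theorem ker_map_mkQ (x : E) (w : ExteriorAlgebra A E)
    (hw : ExteriorAlgebra.map (Submodule.mkQ (Submodule.span A {x})) w = 0) :
    ∃ v, w = ι A x * v := by
  let J : Submodule A (ExteriorAlgebra A E) := LinearMap.range (LinearMap.mulLeft A (ι A x))
  have hJ : ∀ v : E, J ≤ J.comap (LinearMap.mulLeft A (ι A v)) := by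
    rintro v _ ⟨w, rfl⟩
    refine ⟨-(ι A v * w), ?_⟩
    simp [ι_mul_eq x v w]
  let f : E →ₗ[A] Module.End A (ExteriorAlgebra A E ⧸ J) :=
    { toFun := fun v => J.mapQ J (LinearMap.mulLeft A (ι A v)) (hJ v)
      map_add' := fun u v => by
        ext w; simp [add_mul]
      map_smul' := fun c v => by
        ext w; simp }
  have hf : Submodule.span A {x} ≤ LinearMap.ker f := by
    rw [Submodule.span_singleton_le_iff_mem, LinearMap.mem_ker]
    refine LinearMap.ext fun w => ?_
    obtain ⟨w, rfl⟩ := J.mkQ_surjective w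
    change J.mkQ (ι A x * w) = 0
    exact (Submodule.Quotient.mk_eq_zero J).2 ⟨w, rfl⟩
  let g := (Submodule.span A {x}).liftQ f hf
  have hg : ∀ m, g m * g m = 0 := by
    intro m
    obtain ⟨v, rfl⟩ := (Submodule.span A {x}).mkQ_surjective m
    refine LinearMap.ext fun w => ?_
    obtain ⟨w, rfl⟩ := J.mkQ_surjective w
    change J.mkQ (ι A v * (ι A v * w)) = 0
    rw [← mul_assoc, ι_sq_zero, zero_mul, map_zero]
  have key : ∀ w u : ExteriorAlgebra A E,
      ExteriorAlgebra.lift A ⟨g, hg⟩ (ExteriorAlgebra.map (Submodule.mkQ (Submodule.span A {x})) w)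
        (J.mkQ u) = J.mkQ (w * u) := by
    intro w
    induction w using ExteriorAlgebra.induction with
    | algebraMap r => intro u; simp [← Algebra.smul_def]
    | ι v =>
      intro u
      rw [map_apply_ι, lift_ι_apply]
      rfl
    | mul a b ha hb => intro u; rw [map_mul, map_mul, Module.End.mul_apply, hb, ha, mul_assoc]
    | add a b ha hb => intro u; rw [map_add, map_add, LinearMap.add_apply, hb, ha, add_mul, map_add]
  have h := key w 1
  rw [hw, map_zero, LinearMap.zero_apply, mul_one] at h
  obtain ⟨v, hv⟩ := (Submodule.Quotient.mk_eq_zero J).1 h.symm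
  exact ⟨v, hv.symm⟩

theorem lift_eq_zero_of_mul {B : Type*} [Ring B] [Algebra A B] (u : E →ₗ[A] B)
    (hu : ∀ v, u v * u v = 0) (x : E) (hx0 : u x = 0)
    (hx : Function.Injective fun b : B => x ⊗ₜ[A] b)
    (w : ExteriorAlgebra A E) (hw : ι A x * w = 0) :
    ExteriorAlgebra.lift A ⟨u, hu⟩ w = 0 := by
  let m : E →ₗ[A] B →ₗ[A] B := (LinearMap.mul A B).comp u
  have hmm : ∀ v l, m v l = u v * l := fun v l => rfl
  let f : E →ₗ[A] Module.End A (B × (E ⊗[A] B)) :=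
    { toFun := fun v => LinearMap.prod ((m v).comp (LinearMap.fst A _ _))
        ((TensorProduct.mk A E B v).comp (LinearMap.fst A _ _) -
          ((m v).lTensor E).comp (LinearMap.snd A _ _))
      map_add' := fun u v => by
        refine LinearMap.ext fun p => ?_
        refine Prod.ext ?_ ?_
        · simp
        · simp [LinearMap.lTensor_add]; abel
      map_smul' := fun c v => by
        refine LinearMap.ext fun p => ?_
        refine Prod.ext ?_ ?_
        · simp
        · simp [LinearMap.lTensor_smul, smul_sub] }
  have f1 : ∀ v p, (f v p).1 = u v * p.1 := fun v p => rfl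
  have f2 : ∀ v p, (f v p).2 = v ⊗ₜ[A] p.1 - (m v).lTensor E p.2 := fun v p => rfl
  have hf : ∀ v, f v * f v = 0 := by
    intro v
    refine LinearMap.ext fun p => ?_
    rw [Module.End.mul_apply]
    have hm : (m v).comp (m v) = 0 := by
      refine LinearMap.ext fun l => ?_
      simp [hmm, ← mul_assoc, hu]
    have hm2 : (m v).lTensor E ((m v).lTensor E p.2) = 0 := by
      have := LinearMap.lTensor_comp E (m v) (m v)
      rw [hm, LinearMap.lTensor_zero] at this
      exact (LinearMap.congr_fun this p.2).symm
    refine Prod.ext ?_ ?_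
    · rw [f1, f1, ← mul_assoc, hu, zero_mul]; rfl
    · rw [f2, f1, f2, map_sub, LinearMap.lTensor_tmul, hm2, hmm]
      simp
  have key : ∀ w p, (ExteriorAlgebra.lift A ⟨f, hf⟩ w p).1 =
      ExteriorAlgebra.lift A ⟨u, hu⟩ w * p.1 := by
    clear_value f
    intro w
    induction w using ExteriorAlgebra.induction with
    | algebraMap r =>
      intro p
      rw [AlgHom.commutes, AlgHom.commutes, Module.algebraMap_end_apply, Prod.smul_fst,
        Algebra.smul_def]
    | ι v => intro p; rw [lift_ι_apply, lift_ι_apply, f1]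
    | mul a b ha hb => intro p; rw [map_mul, map_mul, Module.End.mul_apply, ha, hb, mul_assoc]
    | add a b ha hb =>
      intro p; rw [map_add, map_add, LinearMap.add_apply, Prod.fst_add, hb, ha, add_mul]
  have h : (ExteriorAlgebra.lift A ⟨f, hf⟩ (ι A x * w) ((1 : B), 0)).2 = 0 := by
    rw [hw, map_zero]; rfl
  have hm0 : m x = 0 := by
    refine LinearMap.ext fun l => ?_
    rw [hmm, hx0]; simp
  rw [map_mul, Module.End.mul_apply, lift_ι_apply, f2, key, hm0, LinearMap.lTensor_zero,
    LinearMap.zero_apply, sub_zero, mul_one] at h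
  apply hx
  simpa using h

theorem map_eq_zero_of_mul (x : E)
    (hx : Function.Injective fun m : ExteriorAlgebra A (E ⧸ Submodule.span A {x}) => x ⊗ₜ[A] m)
    (w : ExteriorAlgebra A E) (hw : ι A x * w = 0) :
    ExteriorAlgebra.map (Submodule.mkQ (Submodule.span A {x})) w = 0 := by
  have hx0 : Submodule.mkQ (Submodule.span A {x}) x = 0 :=
    (Submodule.Quotient.mk_eq_zero _).2 (Submodule.mem_span_singleton_self x)
  have hu : ∀ v, ((ι A).comp (Submodule.mkQ (Submodule.span A {x}))) v *
      ((ι A).comp (Submodule.mkQ (Submodule.span A {x}))) v = 0 := fun v => ι_sq_zero _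
  have h := lift_eq_zero_of_mul ((ι A).comp (Submodule.mkQ (Submodule.span A {x}))) hu x
    (by rw [LinearMap.comp_apply, hx0, map_zero]) hx w hw
  have e : ExteriorAlgebra.map (Submodule.mkQ (Submodule.span A {x})) =
      ExteriorAlgebra.lift A ⟨_, hu⟩ := by
    apply ExteriorAlgebra.hom_ext
    ext v
    simp
  rw [e, h]

theorem koszul_sq {r : ℕ} (x : Fin r → E) (y : (Fin r →₀ ℕ) → ExteriorAlgebra A E)
    (a : Fin r →₀ ℕ) :
    ∑ i, ι A (x i) * ∑ j, ι A (x j) * y (a + Finsupp.single i 1 + Finsupp.single j 1) = 0 := by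
  simp only [Finset.mul_sum]
  rw [← Finset.sum_product']
  refine Finset.sum_involution (fun q _ => q.swap) ?_ ?_ ?_ ?_
  · rintro ⟨i, j⟩ -
    simp only [Prod.fst_swap, Prod.snd_swap]
    rw [ι_mul_eq, add_right_comm a]
    simp
  · rintro ⟨i, j⟩ - h heq
    simp only [Prod.swap_prod_mk, Prod.mk.injEq] at heq
    obtain ⟨rfl, -⟩ := heq
    apply h
    simp [← mul_assoc]
  · simp
  · simp

/-- Exactness of the (infinite, ungraded) Koszul complex. -/
theorem koszul_exact {C : Type*} [AddCommGroup C] [Module A C] [Module.Flat A C] (r : ℕ) :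
    ∀ {E : Type _} [AddCommGroup E] [Module A E] (f : (Fin r → A) →ₗ[A] E) (p : E →ₗ[A] C)
      (_ : Function.Injective f) (_ : Function.Exact f p) (_ : Function.Surjective p)
      (z : (Fin r →₀ ℕ) → ExteriorAlgebra A E)
      (_ : ∀ a, ∑ j, ι A (f (Pi.single j 1)) * z (a + Finsupp.single j 1) = 0)
      (_ : ExteriorAlgebra.map p (z 0) = 0),
      ∃ y : (Fin r →₀ ℕ) → ExteriorAlgebra A E,
        ∀ a, z a = ∑ j, ι A (f (Pi.single j 1)) * y (a + Finsupp.single j 1) := by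
  induction r with
  | zero =>
    intro E _ _ f p hf hfp hp z hz hz0
    refine ⟨fun _ => 0, fun a => ?_⟩
    have hpi : Function.Injective p := by
      rw [injective_iff_map_eq_zero]
      intro e he
      obtain ⟨v, rfl⟩ := (hfp e).1 he
      rw [Subsingleton.elim v 0, map_zero]
    let e := LinearEquiv.ofBijective p ⟨hpi, hp⟩
    have : Function.Injective (ExteriorAlgebra.map p) := by
      refine ExteriorAlgebra.map_injective ⟨e.symm.toLinearMap, ?_⟩
      ext v; exact e.symm_apply_apply v
    rw [Subsingleton.elim a 0]
    simpa using this (hz0.trans (map_zero _).symm)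
  | succ r ih =>
    intro E _ _ f p hf hfp hp z hz hz0
    set x := f (Pi.single 0 1) with hxdef
    set π := Submodule.mkQ (Submodule.span A {x}) with hπ
    -- purity
    have hpure : Function.Injective
        fun m : ExteriorAlgebra A (E ⧸ Submodule.span A {x}) => x ⊗ₜ[A] m := by
      set L := ExteriorAlgebra A (E ⧸ Submodule.span A {x})
      have h1 : Function.Injective (f.lTensor L) :=
        LinearMap.lTensor_injective_of_exact_of_flat p hp f hf hfp L
      have h2 : Function.Injective
          fun m : L => m ⊗ₜ[A] (Pi.single 0 1 : Fin (r + 1) → A) := by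
        intro m m' h
        have := congrArg (fun t => TensorProduct.rid A L ((LinearMap.proj 0).lTensor L t)) h
        simpa using this
      intro m m' h
      apply h2
      apply h1
      have := congrArg (TensorProduct.comm A E L) h
      simpa using this
    let c : (Fin r → A) →ₗ[A] (Fin (r + 1) → A) :=
      { toFun := fun v => Fin.cons 0 v
        map_add' := fun u v => by ext i; refine Fin.cases ?_ (fun j => ?_) i <;> simp
        map_smul' := fun u v => by ext i; refine Fin.cases ?_ (fun j => ?_) i <;> simp }
    have hc : ∀ j, c (Pi.single j 1) = Pi.single j.succ 1 := by
      intro j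
      ext i
      refine Fin.cases ?_ (fun j => ?_) i
      · simp [c]
      · simp [c, Pi.single_apply]
    have hsplit : ∀ v : Fin (r + 1) → A, v = v 0 • Pi.single 0 1 + c (Fin.tail v) := by
      intro v
      ext i
      refine Fin.cases ?_ (fun j => ?_) i
      · simp [c]
      · simp [c, Fin.tail]
    have hpx : p x = 0 := (hfp x).2 ⟨_, rfl⟩
    let p' : (E ⧸ Submodule.span A {x}) →ₗ[A] C :=
      (Submodule.span A {x}).liftQ p (by
        rw [Submodule.span_singleton_le_iff_mem]; exact hpx)
    have hp'π : p'.comp π = p := Submodule.liftQ_mkQ _ _ _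
    let f' := (π.comp f).comp c
    have hf' : Function.Injective f' := by
      rw [injective_iff_map_eq_zero]
      intro v hv
      obtain ⟨t, ht⟩ := Submodule.mem_span_singleton.1 ((Submodule.Quotient.mk_eq_zero _).1 hv)
      rw [hxdef, ← map_smul] at ht
      have h := hf ht
      ext i
      have := congrFun h i.succ
      simpa [c] using this.symm
    have hfp' : Function.Exact f' p' := by
      intro e
      obtain ⟨e, rfl⟩ := Submodule.mkQ_surjective _ e
      constructor
      · intro h
        obtain ⟨v, rfl⟩ := (hfp e).1 h
        refine ⟨Fin.tail v, ?_⟩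
        change π (f (c (Fin.tail v))) = π (f v)
        conv_rhs => rw [hsplit v]
        have hx0 : π x = 0 :=
          (Submodule.Quotient.mk_eq_zero _).2 (Submodule.mem_span_singleton_self x)
        rw [map_add, map_add, map_smul, map_smul, ← hxdef, hx0]; simp
      · rintro ⟨v, hv⟩
        rw [← hv]
        change p (f (c v)) = 0
        exact (hfp _).2 ⟨_, rfl⟩
    have hp' : Function.Surjective p' := by
      intro t
      obtain ⟨e, rfl⟩ := hp t
      exact ⟨π e, rfl⟩
    -- the complex in coordinates
    have hc0 : ∀ (i : ℕ) (a : Fin r →₀ ℕ),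
        Finsupp.cons i a + Finsupp.single 0 1 = Finsupp.cons (i + 1) a := by
      intro i a; ext k
      refine Fin.cases ?_ (fun j => ?_) k <;> simp
    have hcs : ∀ (i : ℕ) (a : Fin r →₀ ℕ) (j : Fin r),
        Finsupp.cons i a + Finsupp.single j.succ 1 = Finsupp.cons i (a + Finsupp.single j 1) := by
      intro i a j; ext k
      refine Fin.cases ?_ (fun j => ?_) k
      · simp
      · simp [Finsupp.single_apply]
    let D : ((Fin r →₀ ℕ) → ExteriorAlgebra A E) → (Fin r →₀ ℕ) → ExteriorAlgebra A E :=
      fun y a => ∑ j, ι A (f (Pi.single (Fin.succ j) 1)) * y (a + Finsupp.single j 1)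
    have hDx : ∀ y a, D (fun b => ι A x * y b) a = - (ι A x * D y a) := by
      intro y a
      simp only [D, Finset.mul_sum, ← Finset.sum_neg_distrib]
      exact Finset.sum_congr rfl fun j _ => ι_mul_eq _ _ _
    have hDD : ∀ y a, D (D y) a = 0 := fun y a =>
      koszul_sq (fun j => f (Pi.single (Fin.succ j) 1)) y a
    have hz' : ∀ i a, D (fun b => z (Finsupp.cons i b)) a
        = - (ι A x * z (Finsupp.cons (i + 1) a)) := by
      intro i a
      have := hz (Finsupp.cons i a)
      rw [Fin.sum_univ_succ, hc0] at this
      simp only [hcs] at this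
      rw [eq_neg_iff_add_eq_zero, add_comm]
      exact this
    have step0 : ∃ y0 y1 : (Fin r →₀ ℕ) → ExteriorAlgebra A E,
        ∀ a, z (Finsupp.cons 0 a) = D y0 a + ι A x * y1 a := by
      have hx0 : π x = 0 :=
          (Submodule.Quotient.mk_eq_zero _).2 (Submodule.mem_span_singleton_self x)
      obtain ⟨yb, hyb⟩ := ih f' p' hf' hfp' hp'
        (fun a => ExteriorAlgebra.map π (z (Finsupp.cons 0 a))) (by
          intro a
          have := congrArg (ExteriorAlgebra.map π) (hz' 0 a)
          simp only [D, map_sum, map_mul, map_neg, map_apply_ι, hx0] at this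
          simpa [f', hc] using this) (by
          have h : ExteriorAlgebra.map p' (ExteriorAlgebra.map π (z (Finsupp.cons 0 0))) =
            ExteriorAlgebra.map p (z 0) := by
            rw [← AlgHom.comp_apply, map_comp_map, hp'π, Finsupp.cons_zero_zero]
          rw [h, hz0])
      have hs : Function.Surjective (ExteriorAlgebra.map π) :=
        ExteriorAlgebra.map_surjective_iff.2 (Submodule.mkQ_surjective _)
      choose y0 hy0 using fun a => hs (yb a)
      have h : ∀ a, ∃ v, z (Finsupp.cons 0 a) - D y0 a = ι A x * v := by
        intro a
        apply ker_map_mkQ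
        rw [map_sub, sub_eq_zero, hyb]
        simp only [D, map_sum, map_mul, map_apply_ι]
        refine Finset.sum_congr rfl fun j _ => ?_
        rw [← hy0, ← hc]
        rfl
      choose y1 hy1 using h
      exact ⟨y0, y1, fun a => by rw [← hy1]; abel⟩
    obtain ⟨y0, y1, h01⟩ := step0
    have step : ∀ i (u v : (Fin r →₀ ℕ) → ExteriorAlgebra A E),
        (∀ a, z (Finsupp.cons i a) = D u a + ι A x * v a) →
        ∃ w : (Fin r →₀ ℕ) → ExteriorAlgebra A E,
          ∀ a, z (Finsupp.cons (i + 1) a) = D v a + ι A x * w a := by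
      intro i u v h
      have h2 : ∀ a, ∃ t, z (Finsupp.cons (i + 1) a) - D v a = ι A x * t := by
        intro a
        apply ker_map_mkQ
        apply map_eq_zero_of_mul x hpure
        have h3 := hz' i a
        have h4 : (fun b => z (Finsupp.cons i b)) = fun b => D u b + ι A x * v b := funext h
        have h5 : D (fun b => D u b + ι A x * v b) a = D (D u) a + D (fun b => ι A x * v b) a := by
          simp only [D, mul_add, Finset.sum_add_distrib]
        rw [h4, h5, hDD, zero_add, hDx, neg_inj] at h3
        rw [mul_sub, h3, sub_self]
      choose w hw using h2
      exact ⟨w, fun a => by rw [← hw]; abel⟩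
    choose W hW using step
    let T : ∀ i, {q : ((Fin r →₀ ℕ) → ExteriorAlgebra A E) × ((Fin r →₀ ℕ) → ExteriorAlgebra A E) //
        ∀ a, z (Finsupp.cons i a) = D q.1 a + ι A x * q.2 a} := fun i =>
      Nat.rec ⟨(y0, y1), h01⟩ (fun i q => ⟨(q.1.2, W i q.1.1 q.1.2 q.2), hW i _ _ q.2⟩) i
    have hT : ∀ i, (T (i + 1)).1.1 = (T i).1.2 := fun i => rfl
    refine ⟨fun b => (T (b 0)).1.1 b.tail, fun b => ?_⟩
    obtain ⟨i, a, rfl⟩ : ∃ i a, b = Finsupp.cons i a := ⟨b 0, b.tail, (Finsupp.cons_tail b).symm⟩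
    rw [Fin.sum_univ_succ, (T i).2 a, add_comm]
    congr 1
    · rw [hc0]
      beta_reduce
      rw [Finsupp.cons_zero, Finsupp.tail_cons, hT]
    · refine Finset.sum_congr rfl fun j _ => ?_
      rw [hcs]
      beta_reduce
      rw [Finsupp.cons_zero, Finsupp.tail_cons]

theorem degSum_add {r : ℕ} (a : Fin r →₀ ℕ) (j : Fin r) :
    degSum (a + Finsupp.single j 1) = degSum a + 1 := by
  unfold degSum
  rw [Finsupp.sum_add_index' (fun _ => rfl) (fun _ _ _ => rfl), Finsupp.sum_single_index rfl]

theorem degSum_sub {r : ℕ} (a : Fin r →₀ ℕ) (j : Fin r) (hj : j ∈ a.support) :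
    degSum (a - Finsupp.single j 1) + 1 = degSum a := by
  rw [← degSum_add, tsub_add_cancel_of_le]
  rw [Finsupp.single_le_iff]
  exact Nat.one_le_iff_ne_zero.2 (Finsupp.mem_support_iff.1 hj)

theorem le_degSum {r : ℕ} (a : Fin r →₀ ℕ) (j : Fin r) : a j ≤ degSum a := by
  by_cases hj : j ∈ a.support
  · exact Finset.single_le_sum (f := fun i => a i) (fun _ _ => Nat.zero_le _) hj
  · simp [Finsupp.notMem_support_iff.1 hj]

theorem eq_zero_of_degSum {r : ℕ} (a : Fin r →₀ ℕ) (h : degSum a = 0) : a = 0 := by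
  ext j
  have := le_degSum a j
  simp only [Finsupp.coe_zero, Pi.zero_apply]
  omega

instance finite_idx (r k : ℕ) : Finite {a : Fin r →₀ ℕ // degSum a = k} := by
  have h := Set.finite_Iic (Finsupp.equivFunOnFinite.symm (fun _ : Fin r => k))
  have h' : {a : Fin r →₀ ℕ | degSum a = k} ⊆
      Set.Iic (Finsupp.equivFunOnFinite.symm (fun _ : Fin r => k)) := by
    rintro a rfl
    intro j
    exact le_degSum a j
  exact (h.subset h').to_subtype

section coords
variable {N : Type*} [AddCommGroup N] [Module A N]

/-- `Γ_k ⊗ N` in coordinates. -/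
noncomputable def gEquiv (A : Type*) [CommRing A] (r k : ℕ) (N : Type*) [AddCommGroup N]
    [Module A N] :
    (Gamma A r k ⊗[A] N) ≃ₗ[A] ({a : Fin r →₀ ℕ // degSum a = k} →₀ N) :=
  TensorProduct.finsuppScalarLeft A N {a : Fin r →₀ ℕ // degSum a = k}

theorem gEquiv_single (r k : ℕ) (s : {a : Fin r →₀ ℕ // degSum a = k}) (n : N) :
    gEquiv A r k N ((Finsupp.single s (1 : A) : Gamma A r k) ⊗ₜ[A] n) = Finsupp.single s n := by
  have h := TensorProduct.finsuppScalarLeft_symm_apply_single (R := A) s n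
  exact ((LinearEquiv.symm_apply_eq _).1 h).symm

theorem gamma_ind {r k : ℕ} {P : Gamma A r k ⊗[A] N → Prop} (h0 : P 0)
    (hadd : ∀ u v, P u → P v → P (u + v))
    (hs : ∀ a (ha : degSum a = k) n,
      P ((Finsupp.single ⟨a, ha⟩ (1 : A) : Gamma A r k) ⊗ₜ[A] n)) (z) : P z := by
  obtain ⟨t, rfl⟩ := (gEquiv A r k N).symm.surjective z
  induction t using Finsupp.induction_linear with
  | zero => rwa [map_zero]
  | add u v hu hv => rw [map_add]; exact hadd _ _ hu hv
  | single s n =>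
    rw [← gEquiv_single (A := A), LinearEquiv.symm_apply_apply]
    exact hs s.1 s.2 n

end coords

/-- Coordinates of an element of `Γ_k ⊗ ⋀^q E`, with values in the exterior algebra. -/
noncomputable def coord (r k q : ℕ) (z : Gamma A r k ⊗[A] ⋀[A]^q E) (a : Fin r →₀ ℕ) :
    ExteriorAlgebra A E :=
  if h : degSum a = k then (gEquiv A r k _ z ⟨a, h⟩ : ExteriorAlgebra A E) else 0

theorem coord_zero (r k q : ℕ) (a) : coord (A := A) (E := E) r k q 0 a = 0 := by
  unfold coord
  split_ifs <;> simp

theorem coord_add (r k q : ℕ) (u v a) :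
    coord (A := A) (E := E) r k q (u + v) a = coord r k q u a + coord r k q v a := by
  unfold coord
  split_ifs <;> simp

theorem coord_sum {ι' : Type*} (s : Finset ι') (r k q : ℕ) (u : ι' → _) (a) :
    coord (A := A) (E := E) r k q (∑ i ∈ s, u i) a = ∑ i ∈ s, coord r k q (u i) a := by
  classical
  induction s using Finset.induction_on with
  | empty => simp [coord_zero]
  | insert i s hi ih => rw [Finset.sum_insert hi, Finset.sum_insert hi, coord_add, ih]

theorem coord_single (r k q : ℕ) (a : Fin r →₀ ℕ) (ha : degSum a = k) (w : ⋀[A]^q E)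
    (b : Fin r →₀ ℕ) :
    coord r k q ((Finsupp.single ⟨a, ha⟩ (1 : A) : Gamma A r k) ⊗ₜ[A] w) b =
      if a = b then (w : ExteriorAlgebra A E) else 0 := by
  classical
  unfold coord
  rw [gEquiv_single]
  split_ifs with h1 h2 h2
  · subst h2; simp
  · rw [Finsupp.single_apply, if_neg]
    · rfl
    · intro h; exact h2 (Subtype.ext_iff.1 h)
  · subst h2; exact absurd ha h1
  · rfl

theorem coord_ext (r k q : ℕ) (u v : Gamma A r k ⊗[A] ⋀[A]^q E)
    (h : ∀ a, coord r k q u a = coord r k q v a) : u = v := by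
  apply (gEquiv A r k _).injective
  ext ⟨a, ha⟩ : 2
  have := h a
  unfold coord at this
  rwa [dif_pos ha, dif_pos ha] at this

theorem coord_mem (r k q : ℕ) (z : Gamma A r k ⊗[A] ⋀[A]^q E) (a) :
    coord r k q z a ∈ ⋀[A]^q E := by
  unfold coord
  split_ifs
  · exact Subtype.prop _
  · exact Submodule.zero_mem _

theorem coord_eq_zero (r k q : ℕ) (z : Gamma A r k ⊗[A] ⋀[A]^q E) (a) (ha : degSum a ≠ k) :
    coord r k q z a = 0 := by
  unfold coord
  rw [dif_neg ha]

theorem exists_coord (r k q : ℕ) (y : (Fin r →₀ ℕ) → ExteriorAlgebra A E)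
    (hy : ∀ a, y a ∈ ⋀[A]^q E) (hy0 : ∀ a, degSum a ≠ k → y a = 0) :
    ∃ z : Gamma A r k ⊗[A] ⋀[A]^q E, ∀ a, coord r k q z a = y a := by
  refine ⟨(gEquiv A r k _).symm (Finsupp.equivFunOnFinite.symm fun s => ⟨y s.1, hy s.1⟩), ?_⟩
  intro a
  unfold coord
  split_ifs with h
  · rw [LinearEquiv.apply_symm_apply]; rfl
  · exact (hy0 a h).symm

theorem homog {r q k : ℕ} (x : Fin r → E) (z y : (Fin r →₀ ℕ) → ExteriorAlgebra A E)
    (hz : ∀ a, z a ∈ ⋀[A]^(q + 1) E) (hz0 : ∀ a, degSum a ≠ k → z a = 0)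
    (hzy : ∀ a, z a = ∑ j, ι A (x j) * y (a + Finsupp.single j 1)) :
    ∃ y' : (Fin r →₀ ℕ) → ExteriorAlgebra A E, (∀ a, y' a ∈ ⋀[A]^q E) ∧
      (∀ a, degSum a ≠ k + 1 → y' a = 0) ∧
      ∀ a, z a = ∑ j, ι A (x j) * y' (a + Finsupp.single j 1) := by
  refine ⟨fun a => if degSum a = k + 1 then
    (DirectSum.decompose (fun i : ℕ => ⋀[A]^i E) (y a) q : ExteriorAlgebra A E) else 0, ?_, ?_, ?_⟩
  · intro a
    beta_reduce
    split_ifs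
    · exact Subtype.prop _
    · exact Submodule.zero_mem _
  · intro a ha
    exact if_neg ha
  · intro a
    by_cases ha : degSum a = k
    · simp only [degSum_add, ha, if_true]
      have h1 : (DirectSum.decompose (fun i : ℕ => ⋀[A]^i E) (z a) (q + 1) :
          ExteriorAlgebra A E) = z a := DirectSum.decompose_of_mem_same _ (hz a)
      rw [← h1, hzy a, DirectSum.decompose_sum, DFinsupp.finsetSum_apply,
        AddSubmonoidClass.coe_finsetSum]
      refine Finset.sum_congr rfl fun j _ => ?_
      exact DirectSum.coe_decompose_mul_of_left_mem_of_le (fun i : ℕ => ⋀[A]^i E)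
        (expOne A (x j)).2 (Nat.le_add_left 1 q)
    · rw [hz0 a ha]
      simp [degSum_add, ha]

theorem homog_zero {r : ℕ} (x : Fin r → E) (z : ExteriorAlgebra A E)
    (y : Fin r → ExteriorAlgebra A E)
    (hz : z ∈ ⋀[A]^0 E) (hzy : z = ∑ j, ι A (x j) * y j) : z = 0 := by
  have h1 : (DirectSum.decompose (fun i : ℕ => ⋀[A]^i E) z 0 :
      ExteriorAlgebra A E) = z := DirectSum.decompose_of_mem_same _ hz
  rw [← h1, hzy, DirectSum.decompose_sum, DFinsupp.finsetSum_apply,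
    AddSubmonoidClass.coe_finsetSum]
  refine Finset.sum_eq_zero fun j _ => ?_
  exact DirectSum.coe_decompose_mul_of_left_mem_of_not_le (fun i : ℕ => ⋀[A]^i E)
        (expOne A (x j)).2 (by omega)

theorem expMap_surj {F : Type*} [AddCommGroup F] [Module A F] (f : E →ₗ[A] F)
    (hf : Function.Surjective f) (q : ℕ) : Function.Surjective (expMap A f q) := by
  intro w
  obtain ⟨v, hv⟩ := exteriorPower.map_surjective (n := q) hf w
  refine ⟨v, ?_⟩
  rw [← hv]
  suffices h : expMap A f q = exteriorPower.map q f by rw [h]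
  ext u : 2
  apply Subtype.ext
  change ExteriorAlgebra.map f (ιMulti A q u) = _
  simp
  rfl

end KosAux

/-- Let `A` be a commutative ring and `φ : E₁ = A^r → E₂` an injective `A`-linear map with
flat cokernel, `E₁` free of finite rank.  For `n = m + 1 ≥ 1` let `Kos(φ, n)` be the
complex with `Kos(φ,n)^q = Γ_{n-q}(E₁) ⊗_A ⋀^q E₂` and differential
`e^{[a]} ⊗ f ↦ Σ_j e^{[a - e_j]} ⊗ φ(e_j) ∧ f`.  Then `H^q(Kos(φ,n)) = 0` for `q ≠ n`
and `H^n(Kos(φ,n)) ≅ ⋀^n coker(φ)`. -/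
theorem koszul_divided_power_cohomology
    (A : Type*) [CommRing A] (r : ℕ)
    (E : Type*) [AddCommGroup E] [Module A E]
    (φ : (Fin r → A) →ₗ[A] E) (hφ : Function.Injective φ)
    (hflat : Module.Flat A (E ⧸ LinearMap.range φ))
    (m : ℕ)
    (d : ∀ q : ℕ,
      (Gamma A r (m + 1 - q) ⊗[A] ⋀[A]^q E) →ₗ[A]
        (Gamma A r (m + 1 - (q + 1)) ⊗[A] ⋀[A]^(q+1) E))
    (hd : ∀ (q : ℕ) (a : Fin r →₀ ℕ) (ha : degSum a = m + 1 - q) (w : ⋀[A]^q E)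
        (ha' : ∀ j ∈ a.support, degSum (a - Finsupp.single j 1) = m + 1 - (q + 1)),
      d q ((Finsupp.single ⟨a, ha⟩ (1 : A) : Gamma A r (m + 1 - q)) ⊗ₜ[A] w) =
        ∑ j ∈ a.support.attach,
          (Finsupp.single ⟨a - Finsupp.single j.1 1, ha' j.1 j.2⟩ (1 : A) :
              Gamma A r (m + 1 - (q + 1))) ⊗ₜ[A]
            wedgeBy A (φ (Pi.single j.1 1)) q w)
    (τ : (Gamma A r (m + 1 - (m + 1)) ⊗[A] ⋀[A]^(m+1) E) →ₗ[A]
      ⋀[A]^(m+1) (E ⧸ LinearMap.range φ))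
    (hτ : ∀ (a : Fin r →₀ ℕ) (ha : degSum a = m + 1 - (m + 1)) (c : A)
        (w : ⋀[A]^(m+1) E),
      τ ((Finsupp.single ⟨a, ha⟩ c : Gamma A r (m + 1 - (m + 1))) ⊗ₜ[A] w) =
        c • expMap A ((LinearMap.range φ).mkQ) (m + 1) w) :

    -- `H^0 = 0`:
    LinearMap.ker (d 0) = ⊥ ∧
    -- `H^q = 0` for `0 < q < n`:
    (∀ q : ℕ, q + 1 ≤ m → LinearMap.range (d q) = LinearMap.ker (d (q + 1))) ∧
    -- `H^n(Kos(φ,n)) ≅ ⋀^n coker(φ)`: the natural map `Kos(φ,n)^n → ⋀^n coker(φ)`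
    -- induced by the projection `E₂ → coker(φ)` is surjective with kernel `im(d^{n-1})`:
    (Function.Surjective τ ∧ LinearMap.ker τ = LinearMap.range (d m)) := by
  classical
  let x : Fin r → E := fun j => φ (Pi.single j 1)
  set p := (LinearMap.range φ).mkQ with hp
  have hpx : ∀ j, p (x j) = 0 := fun j =>
    (Submodule.Quotient.mk_eq_zero _).2 (LinearMap.mem_range_self φ _)
  have hexact : Function.Exact φ p := by
    rw [LinearMap.exact_iff, hp, Submodule.ker_mkQ]
  have hps : Function.Surjective p := Submodule.mkQ_surjective _
  have hdc : ∀ q, q ≤ m → ∀ z a, KosAux.coord r _ _ (d q z) a =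
      ∑ j, ι A (x j) * KosAux.coord r _ _ z (a + Finsupp.single j 1) := by
    intro q hq z b
    induction z using KosAux.gamma_ind with
    | h0 => simp [KosAux.coord_zero]
    | hadd u v hu hv =>
      simp only [map_add, KosAux.coord_add, hu, hv, mul_add, Finset.sum_add_distrib]
    | hs a ha w =>
      have ha' : ∀ j ∈ a.support, degSum (a - Finsupp.single j 1) = m + 1 - (q + 1) := by
        intro j hj
        have := KosAux.degSum_sub a j hj
        omega
      refine (congrArg (fun t => KosAux.coord r _ _ t b) (hd q a ha w ha')).trans ?_
      refine (KosAux.coord_sum _ _ _ _ _ _).trans ?_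
      refine (Finset.sum_congr rfl fun j _ =>
        KosAux.coord_single r _ _ _ (ha' j.1 j.2) _ b).trans ?_
      refine Eq.trans ?_ (Finset.sum_congr rfl fun j _ => congrArg (fun t => ι A (x j) * t)
        (KosAux.coord_single r _ _ a ha w (b + Finsupp.single j 1)).symm)
      rw [Finset.sum_attach a.support (fun j => if a - Finsupp.single j 1 = b then
        ((wedgeBy A (φ (Pi.single j 1)) q w : ⋀[A]^(q+1) E) : ExteriorAlgebra A E) else 0)]
      rw [← Finset.sum_subset (Finset.subset_univ a.support)]
      · refine Finset.sum_congr rfl fun j hj => ?_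
        have hle : Finsupp.single j 1 ≤ a := by
          rw [Finsupp.single_le_iff]
          exact Nat.one_le_iff_ne_zero.2 (Finsupp.mem_support_iff.1 hj)
        have hiff : a - Finsupp.single j 1 = b ↔ a = b + Finsupp.single j 1 :=
          tsub_eq_iff_eq_add_of_le hle
        by_cases h : a = b + Finsupp.single j 1
        · rw [if_pos h, if_pos (hiff.2 h)]; rfl
        · rw [if_neg h, if_neg (fun h' => h (hiff.1 h')), mul_zero]
      · intro j _ hj
        rw [if_neg, mul_zero]
        rintro rfl
        simp at hj
  have hτc : ∀ z, ((τ z : ⋀[A]^(m+1) (E ⧸ LinearMap.range φ)) : ExteriorAlgebra A _) =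
      ExteriorAlgebra.map p (KosAux.coord r _ _ z 0) := by
    intro z
    induction z using KosAux.gamma_ind with
    | h0 => simp [KosAux.coord_zero]
    | hadd u v hu hv =>
      rw [map_add, KosAux.coord_add, map_add, ← hu, ← hv]; rfl
    | hs a ha w =>
      rw [hτ, one_smul, KosAux.coord_single,
        if_pos (KosAux.eq_zero_of_degSum a (by omega))]
      rfl
  have hd0 : degSum (0 : Fin r →₀ ℕ) = 0 := rfl
  have hex : ∀ q k (z : Gamma A r k ⊗[A] ⋀[A]^q E),
      (∀ a, ∑ j, ι A (x j) * KosAux.coord r k q z (a + Finsupp.single j 1) = 0) →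
      ExteriorAlgebra.map p (KosAux.coord r k q z 0) = 0 →
      ∃ y : (Fin r →₀ ℕ) → ExteriorAlgebra A E,
        ∀ a, KosAux.coord r k q z a = ∑ j, ι A (x j) * y (a + Finsupp.single j 1) :=
    fun q k z h1 h2 => KosAux.koszul_exact r φ p hφ hexact hps _ h1 h2
  have hex2 : ∀ q, q ≤ m → ∀ (z : Gamma A r (m + 1 - (q + 1)) ⊗[A] ⋀[A]^(q+1) E),
      (∀ a, ∑ j, ι A (x j) * KosAux.coord r _ _ z (a + Finsupp.single j 1) = 0) →
      ExteriorAlgebra.map p (KosAux.coord r _ _ z 0) = 0 →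
      z ∈ LinearMap.range (d q) := by
    intro q hq z h1 h2
    obtain ⟨y, hy⟩ := hex _ _ z h1 h2
    obtain ⟨y', hy1, hy2, hy3⟩ := KosAux.homog x _ y (KosAux.coord_mem r _ _ z)
      (KosAux.coord_eq_zero r _ _ z) hy
    obtain ⟨t, ht⟩ := KosAux.exists_coord r (m + 1 - q) q y' hy1
      (fun a ha => hy2 a (by omega))
    refine ⟨t, KosAux.coord_ext _ _ _ _ _ fun a => ?_⟩
    rw [hdc q hq, hy3]
    simp only [ht]
  refine ⟨?_, ?_, ?_, ?_⟩
  · rw [LinearMap.ker_eq_bot']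
    intro z hz
    apply KosAux.coord_ext
    intro a
    obtain ⟨y, hy⟩ := hex _ _ z (fun a => by
      rw [← hdc 0 (Nat.zero_le m), hz, KosAux.coord_zero]) (by
      rw [KosAux.coord_eq_zero _ _ _ _ _ (by rw [hd0]; omega), map_zero])
    rw [KosAux.coord_zero]
    exact KosAux.homog_zero x _ _ (KosAux.coord_mem _ _ _ z a) (hy a)
  · intro q hq
    apply le_antisymm
    · rintro _ ⟨z, rfl⟩
      rw [LinearMap.mem_ker]
      apply KosAux.coord_ext
      intro a
      rw [hdc (q + 1) hq, KosAux.coord_zero]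
      simp only [hdc q (by omega)]
      exact KosAux.koszul_sq x _ a
    · intro z hz
      refine hex2 q (by omega) z (fun a => ?_) ?_
      · rw [← hdc (q + 1) hq, LinearMap.mem_ker.1 hz, KosAux.coord_zero]
      · rw [KosAux.coord_eq_zero _ _ _ _ _ (by rw [hd0]; omega), map_zero]
  · intro w
    obtain ⟨v, hv⟩ := KosAux.expMap_surj p hps (m + 1) w
    refine ⟨(Finsupp.single ⟨0, by rw [hd0]; omega⟩ (1 : A) :
      Gamma A r (m + 1 - (m + 1))) ⊗ₜ[A] v, ?_⟩
    rw [hτ, one_smul, hv]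
  · apply le_antisymm
    · intro z hz
      refine hex2 m le_rfl z (fun a => ?_) ?_
      · refine Finset.sum_eq_zero fun j _ => ?_
        rw [KosAux.coord_eq_zero _ _ _ _ _ (by rw [KosAux.degSum_add]; omega), mul_zero]
      · rw [← hτc, LinearMap.mem_ker.1 hz]; rfl
    · rintro _ ⟨z, rfl⟩
      rw [LinearMap.mem_ker]
      apply Subtype.ext
      rw [hτc, hdc m le_rfl, map_sum]
      refine Finset.sum_eq_zero fun j _ => ?_
      rw [map_mul, map_apply_ι, hpx, map_zero, zero_mul]
end

section
/- Let A be a commutative ℚ-algebra and φ : A^r → E an injective A-linear map into a finitely generated projective A-module E with projective cokernel F = coker(φ). Equip the graded algebra Sym_A(A^r) ⊗_A ⋀^• E with the 'graded Hirsch' differential of total degree i in each graded piece (the Koszul differential contracting Sym against wedging by φ of generators). Then for each i ≥ 0 the natural map from the degree-i total complex to ⋀^i F (placed in degree i) is a quasi-isomorphism. -/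
open ExteriorAlgebra TensorProduct MvPolynomial

variable (R : Type*) [CommRing R] (M : Type*) [AddCommGroup M] [Module R M]

variable {M}

variable {N : Type*} [AddCommGroup N] [Module R N]

section GradedKoszul

variable {A : Type*} [CommRing A] {E : Type*} [AddCommGroup E] [Module A E]

theorem gk_coe_wedgeBy (x : E) (q : ℕ) (w : ⋀[A]^q E) :
    ((wedgeBy A x q w : ⋀[A]^(q+1) E) : ExteriorAlgebra A E) = ι A x * (w : ExteriorAlgebra A E) :=
  rfl

theorem gk_coe_expMap {F : Type*} [AddCommGroup F] [Module A F] (f : E →ₗ[A] F) (q : ℕ)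
    (w : ⋀[A]^q E) :
    ((expMap A f q w : ⋀[A]^q F) : ExteriorAlgebra A F) =
      ExteriorAlgebra.map f (w : ExteriorAlgebra A E) :=
  rfl

/-- contraction on the exterior algebra -/
noncomputable def gkC (s : Module.Dual A E) : ExteriorAlgebra A E →ₗ[A] ExteriorAlgebra A E :=
  CliffordAlgebra.contractLeft (Q := (0 : QuadraticForm A E)) s

theorem gkC_ι_mul (s : Module.Dual A E) (a : E) (b : ExteriorAlgebra A E) :
    gkC s (ι A a * b) = s a • b - ι A a * gkC s b :=
  CliffordAlgebra.contractLeft_ι_mul (Q := (0 : QuadraticForm A E)) (d := s) a b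

theorem gkC_zero (s : Module.Dual A E) (x : ExteriorAlgebra A E) (hx : x ∈ ⋀[A]^0 E) :
    gkC s x = 0 := by
  have hx' : x ∈ (1 : Submodule A (ExteriorAlgebra A E)) := by simpa using hx
  obtain ⟨c, rfl⟩ := Submodule.mem_one.1 hx'
  exact CliffordAlgebra.contractLeft_algebraMap (Q := (0 : QuadraticForm A E)) (d := s) c

theorem gkC_mem (s : Module.Dual A E) (q : ℕ) :
    ∀ x : ExteriorAlgebra A E, x ∈ ⋀[A]^(q+1) E → gkC s x ∈ ⋀[A]^q E := by
  induction q with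
  | zero =>
    intro x hx
    have hx' : x ∈ LinearMap.range (ι A (M := E)) := by simpa using hx
    obtain ⟨e, rfl⟩ := hx'
    have := gkC_ι_mul s e 1
    rw [mul_one, gkC_zero s 1 (by simp), mul_zero, sub_zero] at this
    rw [this]
    exact Submodule.smul_mem _ _ (by simp)
  | succ q ih =>
    intro x hx
    change x ∈ LinearMap.range (ι A (M := E)) ^ (q+1+1) at hx
    rw [pow_succ'] at hx
    induction hx using Submodule.mul_induction_on' with
    | mem_mul_mem m hm n hn =>
      obtain ⟨e, rfl⟩ := hm
      rw [gkC_ι_mul]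
      refine Submodule.sub_mem _ (Submodule.smul_mem _ _ hn) ?_
      change _ ∈ LinearMap.range (ι A (M := E)) ^ (q+1)
      rw [pow_succ']
      exact Submodule.mul_mem_mul ⟨e, rfl⟩ (ih n hn)
    | add x hx y hy h1 h2 => rw [map_add]; exact Submodule.add_mem _ h1 h2

/-- contraction in degree `q+1` -/
noncomputable def gkc (s : Module.Dual A E) (q : ℕ) : ⋀[A]^(q+1) E →ₗ[A] ⋀[A]^q E :=
  (gkC s).restrict (gkC_mem s q)

theorem gk_coe_c (s : Module.Dual A E) (q : ℕ) (w : ⋀[A]^(q+1) E) :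
    ((gkc s q w : ⋀[A]^q E) : ExteriorAlgebra A E) = gkC s (w : ExteriorAlgebra A E) := rfl

theorem gk_c_wedge (s : Module.Dual A E) (q : ℕ) (x : E) (w : ⋀[A]^(q+1) E) :
    gkc s (q+1) (wedgeBy A x (q+1) w) = s x • w - wedgeBy A x q (gkc s q w) := by
  ext
  simp [gk_coe_c, gk_coe_wedgeBy, gkC_ι_mul]

theorem gk_c_wedge_zero (s : Module.Dual A E) (x : E) (w : ⋀[A]^0 E) :
    gkc s 0 (wedgeBy A x 0 w) = s x • w := by
  ext
  rw [gk_coe_c, gk_coe_wedgeBy, gkC_ι_mul, gkC_zero s _ w.2]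
  simp

theorem gk_wedge_wedge (q : ℕ) (x y : E) (w : ⋀[A]^q E) :
    wedgeBy A x (q+1) (wedgeBy A y q w) = - wedgeBy A y (q+1) (wedgeBy A x q w) := by
  ext
  simp only [gk_coe_wedgeBy, Submodule.coe_neg, ← mul_assoc]
  rw [eq_neg_iff_add_eq_zero, ← add_mul, ι_add_mul_swap, zero_mul]

section N
variable {r : ℕ} (u : Fin r → E) (s : Fin r → Module.Dual A E)

/-- number operator -/
noncomputable def gkN : ExteriorAlgebra A E →ₗ[A] ExteriorAlgebra A E :=
  ∑ j, LinearMap.mulLeft A (ι A (u j)) ∘ₗ gkC (s j)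

theorem gkN_apply (x : ExteriorAlgebra A E) : gkN u s x = ∑ j, ι A (u j) * gkC (s j) x := by
  simp [gkN]

theorem gkN_ι_mul (e : E) (y : ExteriorAlgebra A E) :
    gkN u s (ι A e * y) = ι A (∑ j, s j e • u j) * y + ι A e * gkN u s y := by
  simp only [gkN_apply, gkC_ι_mul, mul_sub, Finset.sum_sub_distrib, map_sum, Finset.sum_mul,
    Finset.mul_sum, map_smul]
  rw [sub_eq_add_neg, ← Finset.sum_neg_distrib]
  congr 1
  · refine Finset.sum_congr rfl fun j _ => ?_
    rw [mul_smul_comm, smul_mul_assoc]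
  · refine Finset.sum_congr rfl fun j _ => ?_
    rw [← mul_assoc, ← mul_assoc, ← neg_mul, eq_comm]
    congr 1
    rw [eq_neg_iff_add_eq_zero, ι_add_mul_swap]

theorem gk_span (hs : ∀ j k, s j (u k) = if j = k then 1 else 0) (q : ℕ) :
    ⋀[A]^q E ≤ Submodule.span A {x : ExteriorAlgebra A E | x ∈ ⋀[A]^q E ∧
      ∃ k : ℕ, k ≤ q ∧ gkN u s x = (k : A) • x} := by
  induction q with
  | zero =>
    intro x hx
    refine Submodule.subset_span ⟨hx, 0, le_rfl, ?_⟩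
    simp [gkN_apply, gkC_zero _ x hx]
  | succ q ih =>
    change LinearMap.range (ι A (M := E)) ^ (q+1) ≤ _
    rw [pow_succ', Submodule.mul_le]
    rintro _ ⟨e, rfl⟩ n hn
    have hn' := ih hn
    clear hn
    induction hn' using Submodule.span_induction with
    | zero => simp
    | add x y _ _ h1 h2 => rw [mul_add]; exact Submodule.add_mem _ h1 h2
    | smul c x _ h => rw [mul_smul_comm]; exact Submodule.smul_mem _ _ h
    | mem y hy =>
      obtain ⟨hy, k, hk, hN⟩ := hy
      have hmem : ∀ f : E, ι A f * y ∈ ⋀[A]^(q+1) E := by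
        intro f
        change _ ∈ LinearMap.range (ι A (M := E)) ^ (q+1)
        rw [pow_succ']
        exact Submodule.mul_mem_mul ⟨f, rfl⟩ hy
      set p : E := ∑ j, s j e • u j with hp
      have hsp : ∀ j, s j p = s j e := by
        intro j
        simp [hp, hs]
      have : ι A e * y = ι A p * y + ι A (e - p) * y := by
        rw [map_sub, sub_mul]; abel
      rw [this]
      refine Submodule.add_mem _ (Submodule.subset_span ⟨hmem _, k+1, by omega, ?_⟩)
        (Submodule.subset_span ⟨hmem _, k, by omega, ?_⟩)
      · rw [gkN_ι_mul, hN]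
        simp only [hsp]
        rw [← hp, mul_smul_comm, Nat.cast_add, Nat.cast_one, add_smul, one_smul, add_comm]
      · rw [gkN_ι_mul, hN]
        simp [hsp]

end N

section P
variable {r : ℕ}

/-- partial derivative between homogeneous pieces -/
noncomputable def gkD (j : Fin r) (a b : ℕ) (h : b = a - 1) :
    homogeneousSubmodule (Fin r) A a →ₗ[A] homogeneousSubmodule (Fin r) A b :=
  (pderiv j).toLinearMap.restrict (fun p hp => by
    subst h
    exact IsHomogeneous.pderiv hp)

/-- multiplication by a variable between homogeneous pieces -/
noncomputable def gkX (j : Fin r) (a b : ℕ) (h : b = a + 1) :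
    homogeneousSubmodule (Fin r) A a →ₗ[A] homogeneousSubmodule (Fin r) A b :=
  (LinearMap.mulLeft A (X j : MvPolynomial (Fin r) A)).restrict (fun p hp => by
    subst h
    rw [add_comm]
    exact IsHomogeneous.mul (isHomogeneous_X A j) hp)

theorem gk_coe_D (j : Fin r) (a b : ℕ) (h : b = a - 1) (p : homogeneousSubmodule (Fin r) A a) :
    ((gkD j a b h p : homogeneousSubmodule (Fin r) A b) : MvPolynomial (Fin r) A) =
      pderiv j (p : MvPolynomial (Fin r) A) := rfl

theorem gk_coe_X (j : Fin r) (a b : ℕ) (h : b = a + 1) (p : homogeneousSubmodule (Fin r) A a) :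
    ((gkX j a b h p : homogeneousSubmodule (Fin r) A b) : MvPolynomial (Fin r) A) =
      X j * (p : MvPolynomial (Fin r) A) := rfl

theorem gk_pderiv_comm (j k : Fin r) (p : MvPolynomial (Fin r) A) :
    pderiv j (pderiv k p) = pderiv k (pderiv j p) := by
  have h : ⁅(pderiv j : Derivation A (MvPolynomial (Fin r) A) (MvPolynomial (Fin r) A)),
      (pderiv k : Derivation A (MvPolynomial (Fin r) A) (MvPolynomial (Fin r) A))⁆ = 0 := by
    apply MvPolynomial.derivation_ext
    intro i
    rw [Derivation.commutator_apply]
    classical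
    simp only [pderiv_X, Pi.single_apply]
    split_ifs <;> simp
  have h2 := congrArg (fun D => D p) h
  simp only [Derivation.commutator_apply, Derivation.zero_apply] at h2
  exact sub_eq_zero.1 h2

end P

theorem gk_poly [Algebra ℚ A] {V : Type*} [AddCommGroup V] [Module A V] (T : Module.End A V)
    (U : Submodule A V) (hU : ∀ x ∈ U, T x ∈ U) (a : ℕ) (ha : 0 < a) (n : ℕ)
    (S : Set V) (hS : Submodule.span A S = ⊤)
    (hT : ∀ x ∈ S, ∃ k : ℕ, k < n ∧ T x = ((a + k : ℕ) : A) • x) (x : V) (hx : T x ∈ U) :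
    x ∈ U := by
  let P : Polynomial A := ∏ k ∈ Finset.range n, (Polynomial.X - Polynomial.C ((a + k : ℕ) : A))
  have hP : Polynomial.aeval T P = 0 := by
    rw [← LinearMap.ker_eq_top, eq_top_iff, ← hS, Submodule.span_le]
    intro y hy
    obtain ⟨k, hk, hTy⟩ := hT y hy
    have hk' : k ∈ Finset.range n := Finset.mem_range.2 hk
    simp only [P, SetLike.mem_coe, LinearMap.mem_ker]
    rw [← Finset.prod_erase_mul _ _ hk', map_mul, Module.End.mul_apply]
    have : (Polynomial.aeval T) (Polynomial.X - Polynomial.C ((a + k : ℕ) : A)) y = 0 := by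
      rw [map_sub, Polynomial.aeval_X, Polynomial.aeval_C, LinearMap.sub_apply, hTy,
        Module.algebraMap_end_apply, sub_self]
    rw [this, map_zero]
  have hinv : ∀ (Q : Polynomial A), ∀ y ∈ U, Polynomial.aeval T Q y ∈ U := by
    intro Q
    induction Q using Polynomial.induction_on' with
    | add p q hp hq =>
      intro y hy
      rw [map_add, LinearMap.add_apply]
      exact U.add_mem (hp y hy) (hq y hy)
    | monomial n c =>
      intro y hy
      rw [Polynomial.aeval_monomial, Module.End.mul_apply, Module.algebraMap_end_apply]
      refine U.smul_mem _ ?_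
      induction n with
      | zero => simpa using hy
      | succ n ih => rw [pow_succ', Module.End.mul_apply]; exact hU _ ih
  have h0 : Polynomial.aeval T (P.divX * Polynomial.X + Polynomial.C (P.coeff 0)) x = 0 := by
    rw [Polynomial.divX_mul_X_add, hP]; rfl
  rw [map_add, map_mul, Polynomial.aeval_X, Polynomial.aeval_C, LinearMap.add_apply,
    Module.End.mul_apply, Module.algebraMap_end_apply] at h0
  have h1 : P.coeff 0 • x ∈ U := by
    rw [eq_neg_of_add_eq_zero_right h0]
    exact U.neg_mem (hinv _ _ hx)
  have hu : IsUnit (P.coeff 0) := by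
    rw [Polynomial.coeff_zero_eq_eval_zero]
    simp only [P, Polynomial.eval_prod, Polynomial.eval_sub, Polynomial.eval_X, Polynomial.eval_C,
      zero_sub]
    rw [IsUnit.prod_iff]
    intro k _
    rw [IsUnit.neg_iff]
    have : ((a + k : ℕ) : A) = algebraMap ℚ A ((a + k : ℕ) : ℚ) := by simp
    rw [this]
    refine IsUnit.map _ (IsUnit.mk0 _ ?_)
    exact_mod_cast (by omega : a + k ≠ 0)
  obtain ⟨c, hc⟩ := hu
  rw [← hc] at h1
  have := U.smul_mem (↑c⁻¹ : A) h1
  rwa [smul_smul, Units.inv_mul, one_smul] at this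

theorem gk_ker (φ : Submodule A E) (ψ : E →ₗ[A] E) (hψ : ∀ e, e - ψ e ∈ φ) (q : ℕ) :
    ∀ x : ExteriorAlgebra A E, x ∈ ⋀[A]^(q+1) E → x - ExteriorAlgebra.map ψ x ∈
      Submodule.map (ι A) φ * ⋀[A]^q E := by
  have key : ∀ (p : ℕ) (e : E) (y : ExteriorAlgebra A E), y ∈ Submodule.map (ι A) φ * ⋀[A]^p E →
      ι A e * y ∈ Submodule.map (ι A) φ * ⋀[A]^(p+1) E := by
    intro p e y hy
    induction hy using Submodule.mul_induction_on' with
    | mem_mul_mem m hm n hn =>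
      obtain ⟨f, hf, rfl⟩ := hm
      have : ι A e * (ι A f * n) = ι A f * (- ι A e * n) := by
        rw [← mul_assoc, ← mul_assoc]
        congr 1
        rw [mul_neg, eq_neg_iff_add_eq_zero, ι_add_mul_swap]
      rw [this]
      refine Submodule.mul_mem_mul ⟨f, hf, rfl⟩ ?_
      change _ ∈ LinearMap.range (ι A (M := E)) ^ (p+1)
      rw [pow_succ']
      exact Submodule.mul_mem_mul (Submodule.neg_mem _ ⟨e, rfl⟩) hn
    | add x hx y hy h1 h2 => rw [mul_add]; exact Submodule.add_mem _ h1 h2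
  induction q with
  | zero =>
    intro x hx
    have hx' : x ∈ LinearMap.range (ι A (M := E)) := by simpa using hx
    obtain ⟨e, rfl⟩ := hx'
    rw [map_apply_ι, ← map_sub, ← mul_one (ι A (e - ψ e))]
    exact Submodule.mul_mem_mul ⟨_, hψ e, rfl⟩ (by simp)
  | succ q ih =>
    intro x hx
    change x ∈ LinearMap.range (ι A (M := E)) ^ (q+1+1) at hx
    rw [pow_succ'] at hx
    induction hx using Submodule.mul_induction_on' with
    | mem_mul_mem m hm n hn =>
      obtain ⟨e, rfl⟩ := hm
      rw [map_mul, map_apply_ι]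
      have : ι A e * n - ι A (ψ e) * ExteriorAlgebra.map ψ n =
          ι A (e - ψ e) * n + ι A (ψ e) * (n - ExteriorAlgebra.map ψ n) := by
        rw [map_sub, sub_mul, mul_sub]; abel
      rw [this]
      exact Submodule.add_mem _ (Submodule.mul_mem_mul ⟨_, hψ e, rfl⟩ hn) (key _ _ _ (ih n hn))
    | add x hx y hy h1 h2 =>
      rw [map_add, add_sub_add_comm]; exact Submodule.add_mem _ h1 h2

theorem gk_anti [Algebra ℚ A] {V : Type*} [AddCommGroup V] [Module A V] {r : ℕ}
    (f : Fin r → Fin r → V) (hf : ∀ j k, f j k = - f k j) : ∑ j, ∑ k, f j k = 0 := by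
  have hz : ∑ j, ∑ k, f j k = - ∑ j, ∑ k, f j k := by
    conv_lhs => rw [Finset.sum_comm]
    rw [← Finset.sum_neg_distrib]
    refine Finset.sum_congr rfl fun j _ => ?_
    rw [← Finset.sum_neg_distrib]
    exact Finset.sum_congr rfl fun k _ => hf _ _
  have h2 : (2 : A) • (∑ j, ∑ k, f j k) = 0 := by
    rw [two_smul]; nth_rewrite 2 [hz]; exact add_neg_cancel _
  have h3 : (algebraMap ℚ A (1/2)) • (2 : A) • (∑ j, ∑ k, f j k) = 0 := by rw [h2, smul_zero]
  rw [smul_smul, ← map_ofNat (algebraMap ℚ A) 2, ← map_mul] at h3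
  norm_num at h3
  exact h3

theorem gk_comb {V : Type*} [AddCommGroup V] {r : ℕ} (a b c : Fin r → Fin r → V) :
    ((∑ x, ∑ y, a x y) + ∑ x, ∑ y, b x y) + ∑ x, ∑ y, (c x y - b y x) =
      (∑ x, ∑ y, a x y) + ∑ x, ∑ y, c x y := by
  simp only [Finset.sum_sub_distrib]
  rw [Finset.sum_comm (f := fun x y => b y x)]
  abel

end GradedKoszul

set_option maxHeartbeats 2000000 in
/-- Let `A` be a commutative `ℚ`-algebra and `φ : A^r → E` an injective `A`-linear map
into a finitely generated projective `A`-module `E` with projective cokernel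
`F = coker(φ)`.  Equip `Sym_A(A^r) ⊗_A ⋀^• E` with the graded Koszul/Hirsch differential
`u^{[a]} ⊗ f ↦ Σ_j ∂_j u^{[a]} ⊗ φ(u_j) ∧ f`.  Then for each `i = m + 1 ≥ 1` the natural
map from the degree-`i` total complex (with `q`-th term `Sym^{i-q}(A^r) ⊗ ⋀^q E`) to
`⋀^i F` placed in degree `i` is a quasi-isomorphism: the complex is exact in degrees
`< i`, and the natural map `Sym^0 ⊗ ⋀^i E → ⋀^i F` is surjective with kernel the image of
the last differential. -/
theorem graded_koszul_quasiIso_exteriorPower_coker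
    (A : Type*) [CommRing A] [Algebra ℚ A] (r : ℕ)
    (E : Type*) [AddCommGroup E] [Module A E]
    [Module.Finite A E] [Module.Projective A E]
    (φ : (Fin r → A) →ₗ[A] E) (hφ : Function.Injective φ)
    (hproj : Module.Projective A (E ⧸ LinearMap.range φ))
    (m : ℕ)
    -- the degree-`i` total complex, `i = m + 1`:
    (d : ∀ q : ℕ,
      ((homogeneousSubmodule (Fin r) A (m + 1 - q)) ⊗[A] ⋀[A]^q E) →ₗ[A]
        ((homogeneousSubmodule (Fin r) A (m + 1 - (q + 1))) ⊗[A] ⋀[A]^(q+1) E))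
    (hd : ∀ (q : ℕ) (p : MvPolynomial (Fin r) A)
        (hp : p ∈ homogeneousSubmodule (Fin r) A (m + 1 - q))
        (hp' : ∀ j : Fin r, pderiv j p ∈ homogeneousSubmodule (Fin r) A (m + 1 - (q + 1)))
        (w : ⋀[A]^q E),
      d q ((⟨p, hp⟩ : homogeneousSubmodule (Fin r) A (m + 1 - q)) ⊗ₜ[A] w) =
        ∑ j : Fin r,
          (⟨pderiv j p, hp' j⟩ : homogeneousSubmodule (Fin r) A (m + 1 - (q + 1))) ⊗ₜ[A]
            wedgeBy A (φ (Pi.single j 1)) q w)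
    -- the natural map to `⋀^i F` in top degree, induced by `E → F = coker φ`:
    (τ : ((homogeneousSubmodule (Fin r) A (m + 1 - (m + 1))) ⊗[A] ⋀[A]^(m+1) E) →ₗ[A]
      ⋀[A]^(m+1) (E ⧸ LinearMap.range φ))
    (hτ : ∀ (p : MvPolynomial (Fin r) A)
        (hp : p ∈ homogeneousSubmodule (Fin r) A (m + 1 - (m + 1))) (w : ⋀[A]^(m+1) E),
      τ ((⟨p, hp⟩ : homogeneousSubmodule (Fin r) A (m + 1 - (m + 1))) ⊗ₜ[A] w) =
        constantCoeff p • expMap A ((LinearMap.range φ).mkQ) (m + 1) w) :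
    -- exactness in degree `0`:
    LinearMap.ker (d 0) = ⊥ ∧
    -- exactness in degrees `0 < q < i`:
    (∀ q : ℕ, q + 1 ≤ m → LinearMap.range (d q) = LinearMap.ker (d (q + 1))) ∧
    -- quasi-isomorphism onto `⋀^i F` in top degree `i`:
    Function.Surjective τ ∧ LinearMap.ker τ = LinearMap.range (d m) := by
  classical
  obtain ⟨σ, hσ⟩ := LinearMap.exists_rightInverse_of_surjective (LinearMap.range φ).mkQ
    (Submodule.range_mkQ _)
  have hσ' : ∀ y, (LinearMap.range φ).mkQ (σ y) = y := fun y => LinearMap.congr_fun hσ y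
  set ψ : E →ₗ[A] E := σ ∘ₗ (LinearMap.range φ).mkQ with hψdef
  have hψ : ∀ e, e - ψ e ∈ LinearMap.range φ := by
    intro e
    rw [← Submodule.ker_mkQ (LinearMap.range φ), LinearMap.mem_ker, map_sub, hψdef,
      LinearMap.comp_apply, hσ', sub_self]
  let s' : E →ₗ[A] (Fin r → A) := (LinearEquiv.ofInjective φ hφ).symm.toLinearMap ∘ₗ
    (LinearMap.id - ψ).codRestrict (LinearMap.range φ) hψ
  have hs' : ∀ v, s' (φ v) = v := by
    intro v
    simp only [s', LinearMap.comp_apply, LinearEquiv.coe_coe]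
    rw [LinearEquiv.symm_apply_eq]
    ext
    have : (LinearMap.range φ).mkQ (φ v) = 0 := by
      rw [← LinearMap.mem_ker, Submodule.ker_mkQ]; exact ⟨v, rfl⟩
    simp only [LinearMap.codRestrict_apply, LinearMap.sub_apply, LinearMap.id_apply, hψdef,
      LinearMap.comp_apply, this, map_zero, sub_zero, LinearEquiv.ofInjective_apply]
  let s : Fin r → Module.Dual A E := fun j => LinearMap.proj j ∘ₗ s'
  set u : Fin r → E := fun j => φ (Pi.single j 1) with hu
  have hs : ∀ j k, s j (u k) = if j = k then 1 else 0 := by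
    intro j k
    simp [s, hu, hs', Pi.single_apply]
  have hd' : ∀ (q : ℕ) (p : homogeneousSubmodule (Fin r) A (m + 1 - q)) (w : ⋀[A]^q E),
      d q (p ⊗ₜ[A] w) = ∑ j, gkD j (m + 1 - q) (m + 1 - (q + 1)) (by omega) p ⊗ₜ[A]
        wedgeBy A (u j) q w := by
    intro q p w
    exact hd q p.1 p.2 (fun j => (gkD j (m + 1 - q) (m + 1 - (q + 1)) (by omega) p).2) w
  let h : ∀ q : ℕ, q ≤ m → (((homogeneousSubmodule (Fin r) A (m + 1 - (q + 1))) ⊗[A]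
      ⋀[A]^(q+1) E) →ₗ[A] ((homogeneousSubmodule (Fin r) A (m + 1 - q)) ⊗[A] ⋀[A]^q E)) :=
    fun q hq => ∑ j, TensorProduct.map
      (gkX j (m + 1 - (q + 1)) (m + 1 - q) (by omega)) (gkc (s j) q)
  have hh : ∀ (q : ℕ) (hq : q ≤ m) (p : homogeneousSubmodule (Fin r) A (m + 1 - (q + 1)))
      (w : ⋀[A]^(q+1) E), h q hq (p ⊗ₜ[A] w) =
        ∑ j, gkX j (m + 1 - (q + 1)) (m + 1 - q) (by omega) p ⊗ₜ[A] gkc (s j) q w := by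
    intro q hq p w
    simp [h]
  have hEuler : ∀ (q : ℕ) (hq : q ≤ m) (p : homogeneousSubmodule (Fin r) A (m + 1 - q)),
      ∑ j, gkX j (m + 1 - (q + 1)) (m + 1 - q) (by omega)
        (gkD j (m + 1 - q) (m + 1 - (q + 1)) (by omega) p) = ((m + 1 - q : ℕ) : A) • p := by
    intro q hq p
    ext1
    have := IsHomogeneous.sum_X_mul_pderiv p.2
    rw [Submodule.coe_smul, Nat.cast_smul_eq_nsmul, ← this]
    simp only [Submodule.coe_sum, gk_coe_X, gk_coe_D]
  have hdd : ∀ (q : ℕ) x, d (q+1) (d q x) = 0 := by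
    intro q x
    induction x using TensorProduct.induction_on with
    | zero => simp
    | add x y hx hy => simp [hx, hy]
    | tmul p w =>
      simp only [hd', map_sum]
      refine gk_anti (A := A) (V := (homogeneousSubmodule (Fin r) A (m + 1 - (q + 1 + 1))) ⊗[A]
        ⋀[A]^(q+1+1) E)
        (fun j k => gkD k (m + 1 - (q + 1)) (m + 1 - (q + 1 + 1)) (by omega)
          (gkD j (m + 1 - q) (m + 1 - (q + 1)) (by omega) p) ⊗ₜ[A]
            wedgeBy A (u k) (q+1) (wedgeBy A (u j) q w)) fun j k => ?_
      rw [gk_wedge_wedge, TensorProduct.tmul_neg]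
      congr 2
      ext1
      simp only [gk_coe_D]
      exact gk_pderiv_comm _ _ _
  have hT : ∀ (q : ℕ) (hq : q + 1 ≤ m) (p : homogeneousSubmodule (Fin r) A (m + 1 - (q + 1)))
      (w : ⋀[A]^(q+1) E),
      d q (h q (by omega) (p ⊗ₜ[A] w)) + h (q+1) hq (d (q+1) (p ⊗ₜ[A] w)) =
        ((m + 1 - (q + 1) : ℕ) : A) • (p ⊗ₜ[A] w) +
          p ⊗ₜ[A] (∑ j, wedgeBy A (u j) q (gkc (s j) q w)) := by
    intro q hq p w
    have hDX : ∀ k j, gkD k (m + 1 - q) (m + 1 - (q + 1)) (by omega)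
        (gkX j (m + 1 - (q + 1)) (m + 1 - q) (by omega) p) =
        (if j = k then (1 : A) else 0) • p +
          gkX j (m + 1 - (q + 1 + 1)) (m + 1 - (q + 1)) (by omega)
            (gkD k (m + 1 - (q + 1)) (m + 1 - (q + 1 + 1)) (by omega) p) := by
      intro k j
      ext1
      simp only [gk_coe_D, gk_coe_X, Submodule.coe_add, Submodule.coe_smul, pderiv_mul, pderiv_X,
        Pi.single_apply]
      split_ifs <;> simp
    simp only [hh, hd', map_sum, hDX, gk_c_wedge, hs, TensorProduct.add_tmul,
      TensorProduct.tmul_sub, Finset.sum_add_distrib]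
    refine (gk_comb (V := (homogeneousSubmodule (Fin r) A (m + 1 - (q + 1))) ⊗[A] ⋀[A]^(q+1) E)
      (fun x y => ((if x = y then (1 : A) else 0) • p) ⊗ₜ[A]
        wedgeBy A (u y) q (gkc (s x) q w))
      (fun x y => gkX x (m + 1 - (q + 1 + 1)) (m + 1 - (q + 1)) (by omega)
            (gkD y (m + 1 - (q + 1)) (m + 1 - (q + 1 + 1)) (by omega) p) ⊗ₜ[A]
              wedgeBy A (u y) q (gkc (s x) q w))
      (fun x y => gkX y (m + 1 - (q + 1 + 1)) (m + 1 - (q + 1)) (by omega)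
            (gkD x (m + 1 - (q + 1)) (m + 1 - (q + 1 + 1)) (by omega) p) ⊗ₜ[A]
              ((if y = x then (1 : A) else 0) • w))).trans ?_
    simp only [ite_smul, one_smul, zero_smul, TensorProduct.tmul_ite, TensorProduct.ite_tmul,
      Finset.sum_ite_eq, Finset.sum_ite_eq', Finset.mem_univ,
      if_true]
    rw [← TensorProduct.sum_tmul, hEuler (q+1) hq, TensorProduct.tmul_sum,
      ← TensorProduct.smul_tmul']
    exact add_comm _ _
  have hbot : ∀ x, h 0 (Nat.zero_le _) (d 0 x) = ((m + 1 - 0 : ℕ) : A) • x := by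
    intro x
    induction x using TensorProduct.induction_on with
    | zero => simp
    | add x y hx hy => rw [map_add, map_add, hx, hy, smul_add]
    | tmul p w =>
      simp only [hh, hd', map_sum, gk_c_wedge_zero, hs]
      rw [Finset.sum_comm]
      simp only [ite_smul, one_smul, zero_smul, TensorProduct.tmul_ite,
        Finset.sum_ite_eq, Finset.mem_univ, if_true]
      rw [← TensorProduct.sum_tmul, hEuler 0 (Nat.zero_le _), ← TensorProduct.smul_tmul']
  have h1mem : (1 : MvPolynomial (Fin r) A) ∈ homogeneousSubmodule (Fin r) A (m + 1 - (m + 1)) := by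
    rw [Nat.sub_self]; exact isHomogeneous_one _ _
  let one : homogeneousSubmodule (Fin r) A (m + 1 - (m + 1)) := ⟨1, h1mem⟩
  have hτ1 : ∀ w, τ (one ⊗ₜ[A] w) = expMap A ((LinearMap.range φ).mkQ) (m + 1) w := by
    intro w
    rw [hτ 1 h1mem w, map_one, one_smul]
  refine ⟨?_, ?_, ?_, ?_⟩
  · rw [LinearMap.ker_eq_bot']
    intro x hx
    have h1 := hbot x
    rw [hx, map_zero] at h1
    have h3 : (algebraMap ℚ A (1/((m + 1 - 0 : ℕ) : ℚ))) • ((m + 1 - 0 : ℕ) : A) • x = 0 := by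
      rw [← h1, smul_zero]
    rw [smul_smul, ← map_natCast (algebraMap ℚ A), ← map_mul, one_div, inv_mul_cancel₀, map_one,
      one_smul] at h3
    · exact h3
    · exact_mod_cast (by omega : m + 1 - 0 ≠ 0)
  · intro q hq
    apply le_antisymm
    · rintro _ ⟨x, rfl⟩
      exact hdd q x
    · intro x hx
      rw [LinearMap.mem_ker] at hx
      let T : Module.End A ((homogeneousSubmodule (Fin r) A (m + 1 - (q + 1))) ⊗[A] ⋀[A]^(q+1) E) :=
        d q ∘ₗ h q (by omega) + h (q+1) hq ∘ₗ d (q+1)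
      have hTa : ∀ x, T x = d q (h q (by omega) x) + h (q+1) hq (d (q+1) x) := fun x => rfl
      refine gk_poly T (LinearMap.range (d q)) ?_ (m + 1 - (q + 1)) (by omega) (q + 2)
        {t | ∃ p w, (∃ k : ℕ, k ≤ q + 1 ∧ gkN u s (w : ⋀[A]^(q+1) E).1 = (k : A) • w.1) ∧
          t = p ⊗ₜ[A] w} ?_ ?_ x ?_
      · rintro _ ⟨y, rfl⟩
        rw [hTa, hdd, map_zero, add_zero]
        exact ⟨_, rfl⟩
      · rw [eq_top_iff, ← TensorProduct.span_tmul_eq_top, Submodule.span_le]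
        rintro _ ⟨p, w, rfl⟩
        have hw := gk_span u s hs (q+1) w.2
        have hle : Submodule.span A {x : ExteriorAlgebra A E | x ∈ ⋀[A]^(q+1) E ∧
            ∃ k : ℕ, k ≤ q+1 ∧ gkN u s x = (k : A) • x} ≤
            (Submodule.comap (TensorProduct.mk A (homogeneousSubmodule (Fin r) A (m + 1 - (q + 1)))
              (⋀[A]^(q+1) E) p) (Submodule.span A {t | ∃ p w, (∃ k : ℕ, k ≤ q + 1 ∧
                gkN u s (w : ⋀[A]^(q+1) E).1 = (k : A) • w.1) ∧ t = p ⊗ₜ[A] w})).map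
              (⋀[A]^(q+1) E).subtype := by
          rw [Submodule.span_le]
          rintro y ⟨hy, k, hk, hN⟩
          exact ⟨⟨y, hy⟩, Submodule.subset_span ⟨p, ⟨y, hy⟩, ⟨k, hk, hN⟩, rfl⟩, rfl⟩
        obtain ⟨w', hw', hww⟩ := hle hw
        have : w' = w := Subtype.ext hww
        subst this
        exact hw'
      · rintro _ ⟨p, w, ⟨k, hk, hN⟩, rfl⟩
        refine ⟨k, by omega, ?_⟩
        rw [hTa, hT q hq p w]
        have : (∑ j, wedgeBy A (u j) q (gkc (s j) q w)) = (k : A) • w := by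
          ext1
          rw [Submodule.coe_smul, ← hN, gkN_apply, Submodule.coe_sum]
          rfl
        rw [this, TensorProduct.tmul_smul, Nat.cast_add, add_smul]
      · rw [hTa, hx, map_zero, add_zero]
        exact ⟨_, rfl⟩
  · intro y
    refine ⟨one ⊗ₜ[A] expMap A σ (m + 1) y, ?_⟩
    rw [hτ1]
    ext1
    rw [gk_coe_expMap, gk_coe_expMap, ← AlgHom.comp_apply, map_comp_map, hσ, ExteriorAlgebra.map_id]
    rfl
  · apply le_antisymm
    · intro x hx
      have hone : ∃ w, x = one ⊗ₜ[A] w := by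
        clear hx
        induction x using TensorProduct.induction_on with
        | zero => exact ⟨0, by simp⟩
        | add x y hx hy =>
          obtain ⟨a, rfl⟩ := hx
          obtain ⟨b, rfl⟩ := hy
          exact ⟨a + b, by rw [TensorProduct.tmul_add]⟩
        | tmul p w =>
          obtain ⟨p, hp⟩ := p
          have hp2 : p.IsHomogeneous 0 := by
            have := hp
            rw [Nat.sub_self] at this
            exact this
          rw [← totalDegree_zero_iff_isHomogeneous, totalDegree_eq_zero_iff_eq_C] at hp2
          refine ⟨coeff 0 p • w, ?_⟩
          rw [← TensorProduct.smul_tmul]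
          congr 1
          ext1
          change p = coeff 0 p • (1 : MvPolynomial (Fin r) A)
          rw [smul_eq_C_mul, mul_one]
          exact hp2
      obtain ⟨w, rfl⟩ := hone
      rw [LinearMap.mem_ker, hτ1] at hx
      have hw := gk_ker (LinearMap.range φ) ψ hψ m w.1 w.2
      have hz : ExteriorAlgebra.map ψ w.1 = 0 := by
        have hx2 := congrArg Subtype.val hx
        rw [gk_coe_expMap] at hx2
        rw [hψdef, ← map_comp_map, AlgHom.comp_apply, hx2]
        simp
      rw [hz, sub_zero] at hw
      have hle : Submodule.map (ι A) (LinearMap.range φ) * ⋀[A]^m E ≤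
          (Submodule.comap (TensorProduct.mk A (homogeneousSubmodule (Fin r) A (m + 1 - (m + 1)))
              (⋀[A]^(m+1) E) one) (LinearMap.range (d m))).map (⋀[A]^(m+1) E).subtype := by
        rw [Submodule.mul_le]
        rintro _ ⟨_, ⟨v, rfl⟩, rfl⟩ n hn
        refine ⟨wedgeBy A (φ v) m ⟨n, hn⟩, ?_, rfl⟩
        have hXm : ∀ j, (X j : MvPolynomial (Fin r) A) ∈
            homogeneousSubmodule (Fin r) A (m + 1 - m) := by
          intro j
          rw [Nat.add_sub_cancel_left]
          exact isHomogeneous_X A j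
        refine ⟨(∑ j, v j • (⟨X j, hXm j⟩ : homogeneousSubmodule (Fin r) A (m + 1 - m))) ⊗ₜ[A]
          (⟨n, hn⟩ : ⋀[A]^m E), ?_⟩
        rw [hd']
        have hDv : ∀ k, gkD k (m + 1 - m) (m + 1 - (m + 1)) (by omega)
            (∑ j, v j • (⟨X j, hXm j⟩ : homogeneousSubmodule (Fin r) A (m + 1 - m))) =
            v k • one := by
          intro k
          ext1
          simp only [gk_coe_D, Submodule.coe_sum, Submodule.coe_smul, map_sum, Derivation.map_smul,
            pderiv_X, Pi.single_apply, one]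
          simp
        simp only [hDv, TensorProduct.smul_tmul]
        rw [← TensorProduct.tmul_sum]
        change _ = one ⊗ₜ[A] _
        congr 1
        ext1
        simp only [Submodule.coe_sum, Submodule.coe_smul, gk_coe_wedgeBy, hu]
        have hv : φ v = ∑ j, v j • φ (Pi.single j 1) := by
          conv_lhs => rw [pi_eq_sum_univ' v]
          simp only [map_sum, map_smul]
        rw [hv, map_sum, Finset.sum_mul]
        simp only [map_smul, smul_mul_assoc]
      obtain ⟨w', hw', hww⟩ := hle hw
      have : w' = w := Subtype.ext hww
      subst this
      exact hw'
    · rintro _ ⟨x, rfl⟩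
      rw [LinearMap.mem_ker]
      induction x using TensorProduct.induction_on with
      | zero => simp
      | add x y hx hy => rw [map_add, map_add, hx, hy, add_zero]
      | tmul p w =>
        rw [hd', map_sum]
        refine Finset.sum_eq_zero fun j _ => ?_
        have h0 : expMap A ((LinearMap.range φ).mkQ) (m + 1) (wedgeBy A (u j) m w) = 0 := by
          ext1
          rw [gk_coe_expMap, gk_coe_wedgeBy, map_mul, map_apply_ι]
          have : (LinearMap.range φ).mkQ (u j) = 0 := by
            rw [← LinearMap.mem_ker, Submodule.ker_mkQ]; exact ⟨_, rfl⟩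
          rw [this]
          simp
        have := hτ _ (gkD j (m + 1 - m) (m + 1 - (m + 1)) (by omega) p).2 (wedgeBy A (u j) m w)
        rw [h0, smul_zero] at this
        exact this
end

section
/- Let A be a commutative ℚ-algebra, r ≥ 1, and let C• be a bounded-below complex of A-modules which is a dg-module over a commutative dga with fixed cocycles ω_1, ..., ω_r ∈ Z^1. Suppose that for each i, wedging with ω_i on the iterated quotient C_i• := C•/(ω_1,...,ω_i)∧ gives, for all q, short exact sequences 0 → H^{q-1}(C_i•) → H^q(C_{i-1}•) → H^q(C_i•) → 0. Then the projection from the r-variable Hirsch extension Sym_A(A^r) ⊗_A C• (with d(u_i) = ω_i) to C_r• = C•/(ω_1,...,ω_r)∧ is a quasi-isomorphism. -/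
open TensorProduct MvPolynomial

namespace HirschAux

theorem smul_cancel {A M : Type*} [CommRing A] [Algebra ℚ A] [AddCommGroup M] [Module A M]
    (n : ℕ) (x : M) (h : ((n + 1 : ℕ) : A) • x = 0) : x = 0 := by
  have h1 : (algebraMap ℚ A ((n + 1 : ℕ) : ℚ)⁻¹) * ((n + 1 : ℕ) : A) = 1 := by
    rw [← map_natCast (algebraMap ℚ A) (n + 1), ← map_mul, inv_mul_cancel₀, map_one]
    exact_mod_cast Nat.succ_ne_zero n
  rw [← one_smul A x, ← h1, mul_smul, h, smul_zero]

/-- Antiderivatives. -/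
theorem exists_anti {A M : Type*} [CommRing A] [Algebra ℚ A] [AddCommGroup M] [Module A M]
    {r : ℕ} (D U : Fin r → M →ₗ[A] M)
    (hDU : ∀ j x, D j (U j x) = U j (D j x) + x)
    (hDU' : ∀ j k x, j ≠ k → D j (U k x) = U k (D j x))
    (i : Fin r) (a : M) (ha : ∀ j : Fin r, (i : ℕ) ≤ j → D j a = 0) (N : ℕ) :
    ∀ n : ℕ, ∃ b : M, (∀ j : Fin r, (i : ℕ) + 1 ≤ j → D j b = 0) ∧
      (D i ^ N) b = (U i ^ n) a := by
  have hstep : ∀ n : ℕ, D i ((U i ^ (n + 1)) a) = ((n + 1 : ℕ) : A) • (U i ^ n) a := by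
    intro n
    induction n with
    | zero => simp [hDU, ha i le_rfl]
    | succ n ih =>
      rw [pow_succ', Module.End.mul_apply, hDU, ih, map_smul, ← Module.End.mul_apply,
        ← pow_succ']
      push_cast
      module
  induction N with
  | zero =>
    intro n
    refine ⟨(U i ^ n) a, ?_, by simp⟩
    intro j hj
    induction n with
    | zero => simpa using ha j (by omega)
    | succ n ih =>
      rw [pow_succ', Module.End.mul_apply, hDU', ih, map_zero]
      rintro rfl
      omega
  | succ N ih =>
    intro n
    obtain ⟨b, hb, hb'⟩ := ih (n + 1)
    refine ⟨(algebraMap ℚ A ((n + 1 : ℕ) : ℚ)⁻¹) • b, ?_, ?_⟩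
    · intro j hj
      rw [map_smul, hb j hj, smul_zero]
    · have h1 : (algebraMap ℚ A ((n + 1 : ℕ) : ℚ)⁻¹) * ((n + 1 : ℕ) : A) = 1 := by
        rw [← map_natCast (algebraMap ℚ A) (n + 1), ← map_mul, inv_mul_cancel₀, map_one]
        exact_mod_cast Nat.succ_ne_zero n
      rw [map_smul, pow_succ', Module.End.mul_apply, hb', hstep, smul_smul, h1, one_smul]

theorem main_aux
    (A : Type*) [CommRing A] [Algebra ℚ A] (r : ℕ)
    (C : ℤ → Type*) [∀ q, AddCommGroup (C q)] [∀ q, Module A (C q)]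
    (d : ∀ q : ℤ, C q →ₗ[A] C (q + 1))
    (mulω : Fin r → ∀ q : ℤ, C q →ₗ[A] C (q + 1))
    (hLeib : ∀ k q (c : C q), d (q + 1) (mulω k q c) = - mulω k (q + 1) (d q c))
    (hanti : ∀ k l q (c : C q),
      mulω k (q + 1) (mulω l q c) = - mulω l (q + 1) (mulω k q c))
    (Si : ℕ → ∀ q : ℤ, Submodule A (C (q + 1)))
    (hSi : ∀ i q, Si i q =
      ⨆ j : Fin r, ⨆ _ : (j : ℕ) < i, LinearMap.range (mulω j q))
    (hinj : ∀ (i : Fin r) (q : ℤ) (c : C (q + 1)),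
      d (q + 1) c ∈ Si (i + 1) (q + 1) →
      (∃ b : C (q + 1), mulω i (q + 1) c - d (q + 1) b ∈ Si i (q + 1)) →
      ∃ a : C q, c - d q a ∈ Si (i + 1) q)
    (hmid : ∀ (i : Fin r) (q : ℤ) (z : C (q + 1 + 1)),
      d (q + 1 + 1) z ∈ Si i (q + 1 + 1) →
      (∃ b : C (q + 1), z - d (q + 1) b ∈ Si (i + 1) (q + 1)) →
      ∃ c : C (q + 1), d (q + 1) c ∈ Si (i + 1) (q + 1) ∧
        ∃ a : C (q + 1), z - mulω i (q + 1) c - d (q + 1) a ∈ Si i (q + 1))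
    (hsurj : ∀ (i : Fin r) (q : ℤ) (z : C (q + 1)),
      d (q + 1) z ∈ Si (i + 1) (q + 1) →
      ∃ c : C (q + 1), d (q + 1) c ∈ Si i (q + 1) ∧
        ∃ b : C q, z - c - d q b ∈ Si (i + 1) q)
    (H : ℤ → Type*) [∀ q, AddCommGroup (H q)] [∀ q, Module A (H q)]
    (dH : ∀ q : ℤ, H q →ₗ[A] H (q + 1))
    (hdH2 : ∀ q x, dH (q + 1) (dH q x) = 0)
    (D U : ∀ q : ℤ, Fin r → H q →ₗ[A] H q)
    (W : Fin r → ∀ q : ℤ, H q →ₗ[A] H (q + 1))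
    (ε : ∀ q : ℤ, H q →ₗ[A] C q)
    (ι : ∀ q : ℤ, C q →ₗ[A] H q)
    (hDD : ∀ q j k x, D q j (D q k x) = D q k (D q j x))
    (hDU : ∀ q j x, D q j (U q j x) = U q j (D q j x) + x)
    (hDU' : ∀ q j k x, j ≠ k → D q j (U q k x) = U q k (D q j x))
    (hdD : ∀ q j x, dH q (D q j x) = D (q + 1) j (dH q x))
    (hDW : ∀ q j k x, D (q + 1) j (W k q x) = W k q (D q j x))
    (hdU : ∀ q j x, dH q (U q j x) = U (q + 1) j (dH q x) + W j q x)
    (hεW : ∀ q j x, ε (q + 1) (W j q x) = mulω j q (ε q x))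
    (hεd : ∀ q x, ε (q + 1) (dH q x) = d q (ε q x) + ∑ k, mulω k q (ε q (D q k x)))
    (hDι : ∀ q j c, D q j (ι q c) = 0)
    (hdι : ∀ q c, dH q (ι q c) = ι (q + 1) (d q c))
    (hει : ∀ q c, ε q (ι q c) = c)
    (hker : ∀ q x, (∀ j, D q j x = 0) → x = ι q (ε q x))
    (hnil : ∀ q j x, ∃ N : ℕ, (D q j ^ N) x = 0) (i : ℕ) (hir : i ≤ r) :
    (∀ (q : ℤ) (x : H (q + 1 + 1)), (∀ j : Fin r, i ≤ j → D _ j x = 0) → dH _ x = 0 →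
      (∃ b : C (q + 1), ε _ x - d _ b ∈ Si i (q + 1)) →
      ∃ a : H (q + 1), (∀ j : Fin r, i ≤ j → D _ j a = 0) ∧ dH _ a = x) ∧
    (∀ (q : ℤ) (z : C (q + 1)), d _ z ∈ Si i (q + 1) →
      ∃ x : H (q + 1), (∀ j : Fin r, i ≤ j → D _ j x = 0) ∧ dH _ x = 0 ∧
        ∃ b : C q, z - ε _ x - d _ b ∈ Si i q) := by
  have hSle : ∀ i i' q, i ≤ i' → Si i q ≤ Si i' q := by
    intro i i' q h
    rw [hSi, hSi]
    refine iSup_mono fun j => ?_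
    exact iSup_le fun hj => le_iSup_of_le (lt_of_lt_of_le hj h) le_rfl
  have hSmem : ∀ (i : ℕ) (j : Fin r) q c, (j : ℕ) < i → mulω j q c ∈ Si i q := by
    intro i j q c h
    rw [hSi]
    exact Submodule.mem_iSup_of_mem j (Submodule.mem_iSup_of_mem h ⟨c, rfl⟩)
  have hsq : ∀ k q c, mulω k (q + 1) (mulω k q c) = 0 := by
    intro k q c
    apply smul_cancel (A := A) 1
    have h := hanti k k q c
    rw [eq_neg_iff_add_eq_zero] at h
    push_cast
    rw [← h]
    module
  have hSω : ∀ (i : Fin r) q (s : C (q + 1)), s ∈ Si (i + 1) q →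
      mulω i (q + 1) s ∈ Si i (q + 1) := by
    intro i q s hs
    have : Si (i + 1) q ≤ (Si i (q + 1)).comap (mulω i (q + 1)) := by
      rw [hSi]
      refine iSup_le fun j => iSup_le fun hj => ?_
      rintro _ ⟨c, rfl⟩
      rw [Submodule.mem_comap]
      by_cases hji : j = i
      · subst hji
        rw [hsq]
        exact Submodule.zero_mem _
      · rw [hanti]
        refine Submodule.neg_mem _ (hSmem _ _ _ _ ?_)
        have : (j : ℕ) ≠ i := fun h => hji (Fin.ext h)
        omega
    exact this hs
  have hεd' : ∀ (i : ℕ) q (x : H q), (∀ j : Fin r, i ≤ j → D _ j x = 0) →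
      ε (q + 1) (dH q x) - d q (ε q x) ∈ Si i q := by
    intro i q x hx
    rw [hεd, add_sub_cancel_left]
    refine Submodule.sum_mem _ fun k _ => ?_
    by_cases hk : (k : ℕ) < i
    · exact hSmem _ _ _ _ hk
    · rw [hx k (by omega)]
      simp
  have hpowd : ∀ N q j x, dH q ((D q j ^ N) x) = (D (q + 1) j ^ N) (dH q x) := by
    intro N q j x
    induction N with
    | zero => simp
    | succ N ih => rw [pow_succ', pow_succ', Module.End.mul_apply, Module.End.mul_apply, hdD, ih]
  have hpowD : ∀ N q j k x, D q k x = 0 → D q k ((D q j ^ N) x) = 0 := by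
    intro N q j k x hx
    induction N with
    | zero => simpa using hx
    | succ N ih => rw [pow_succ', Module.End.mul_apply, hDD, ih, map_zero]
  induction i with
  | zero =>
    have h0 : ∀ q, Si 0 q = ⊥ := by
      intro q
      rw [hSi]
      simp
    simp only [h0, Submodule.mem_bot, sub_eq_zero]
    constructor
    · rintro q x hx hdx ⟨b, hb⟩
      refine ⟨ι _ b, fun j _ => hDι _ _ _, ?_⟩
      rw [hdι, ← hb, ← hker _ x fun j => hx j (Nat.zero_le _)]
    · intro q z hz
      refine ⟨ι _ z, fun j _ => hDι _ _ _, by rw [hdι, hz, map_zero], 0, ?_⟩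
      rw [hει]
      simp
  | succ i ih =>
    obtain ⟨ihI, ihS⟩ := ih (by omega)
    obtain ⟨i, rfl⟩ : ∃ i' : Fin r, (i' : ℕ) = i := ⟨⟨i, by omega⟩, rfl⟩
    refine ⟨?_, ?_⟩
    · intro q
      -- key decomposition
      have key : ∀ y : H (q + 1 + 1), (∀ j : Fin r, (i : ℕ) ≤ j → D _ j y = 0) → dH _ y = 0 →
          (∃ b : C (q + 1), ε _ y - d _ b ∈ Si (i + 1) (q + 1)) →
          ∃ y' a : H (q + 1), (∀ j : Fin r, (i : ℕ) ≤ j → D _ j y' = 0) ∧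
            (∀ j : Fin r, (i : ℕ) ≤ j → D _ j a = 0) ∧ dH _ y' = 0 ∧
            W i _ y' + dH _ a = y := by
        intro y hy hdy hb
        have hdεy : d _ (ε _ y) ∈ Si i (q + 1 + 1) := by
          have := hεd' i _ y hy
          rw [hdy, map_zero, zero_sub] at this
          simpa using this
        obtain ⟨c, hc, a, ha⟩ := hmid i q (ε _ y) hdεy hb
        obtain ⟨c', hc', b, hb⟩ := hsurj i q c hc
        obtain ⟨y', hy', hdy', b', hb'⟩ := ihS q c' hc'
        obtain ⟨a', ha', hda'⟩ := ihI q (y - W i _ y') (by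
            intro j hj
            rw [map_sub, hy j hj, hDW, hy' j hj, map_zero, sub_zero]) (by
            have h1 := hdU _ i y'
            have h2 := hdH2 _ (U _ i y')
            rw [h1, hdy', map_zero, zero_add] at h2
            rw [map_sub, hdy, h2, sub_zero])
          ⟨a - mulω i _ (b + b'), by
            have e1 := hSω i _ _ hb
            have e2 := hSω i _ _ (hSle i (i + 1) _ (Nat.le_succ _) hb')
            have e3 := Submodule.add_mem _ (Submodule.add_mem _ ha e1) e2
            convert e3 using 1
            simp only [map_sub, map_add, hLeib, hεW]
            abel⟩
        exact ⟨y', a', hy', ha', hdy', by rw [hda']; abel⟩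
      have main : ∀ (N : ℕ) (x : H (q + 1 + 1)), (D _ i ^ N) x = 0 →
          (∀ j : Fin r, (i : ℕ) + 1 ≤ j → D _ j x = 0) → dH _ x = 0 →
          (∃ b : C (q + 1), ε _ x - d _ b ∈ Si (i + 1) (q + 1)) →
          ∃ a : H (q + 1), (∀ j : Fin r, (i : ℕ) + 1 ≤ j → D _ j a = 0) ∧ dH _ a = x := by
        intro N
        induction N with
        | zero =>
          intro x hx _ _ _
          refine ⟨0, by simp, ?_⟩
          simpa using hx.symm
        | succ N ihN =>
          intro x hN hx hdx hb
          have hDlt : ∀ j : Fin r, (i : ℕ) ≤ j → D _ j ((D _ i ^ N) x) = 0 := by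
            intro j hj
            by_cases hji : j = i
            · subst hji
              rw [← Module.End.mul_apply, ← pow_succ', hN]
            · have : (j : ℕ) ≠ i := fun h => hji (Fin.ext h)
              exact hpowD _ _ _ _ _ (hx j (by omega))
          have hdy : dH _ ((D _ i ^ N) x) = 0 := by rw [hpowd, hdx, map_zero]
          have hex : ∃ b : C (q + 1),
              ε _ ((D _ i ^ N) x) - d _ b ∈ Si (i + 1) (q + 1) := by
            cases N with
            | zero => simpa using hb
            | succ N =>
              set y := (D _ i ^ (N + 1)) x with hy
              set w := (D _ i ^ N) x with hw
              have hyw : D _ i w = y := by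
                rw [hy, hw, pow_succ', Module.End.mul_apply]
              have hdw : dH _ w = 0 := by rw [hw, hpowd, hdx, map_zero]
              have hw0 : ∀ j : Fin r, (i : ℕ) ≤ j → D _ j (U _ i y - w) = 0 := by
                intro j hj
                by_cases hji : j = i
                · subst hji
                  rw [map_sub, hDU, hDlt j le_rfl, hyw]
                  simp
                · have : (j : ℕ) ≠ i := fun h => hji (Fin.ext h)
                  rw [map_sub, hDU' _ _ _ _ hji, hDlt j hj, hw,
                    hpowD _ _ _ _ _ (hx j (by omega))]
                  simp
              have hdw0 : dH _ (U _ i y - w) = W i _ y := by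
                rw [map_sub, hdU, hdy, hdw]
                simp
              refine hinj i (q + 1) (ε _ y) ?_ ⟨ε _ (U _ i y - w), ?_⟩
              · have := hεd' (i + 1) _ y fun j hj => hDlt j (by omega)
                rw [hdy, map_zero, zero_sub] at this
                simpa using this
              · have := hεd' i _ _ hw0
                rwa [hdw0, hεW] at this
          obtain ⟨y', a, hy', ha, hdy', hya⟩ := key _ hDlt hdy hex
          obtain ⟨b1, hb1, hb1'⟩ := exists_anti (D (q + 1)) (U (q + 1)) (hDU _) (hDU' _) i y' hy' N 1
          obtain ⟨b2, hb2, hb2'⟩ := exists_anti (D (q + 1)) (U (q + 1)) (hDU _) (hDU' _) i a ha N 0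
          have hbb : ∀ j : Fin r, (i : ℕ) + 1 ≤ j → D _ j (b1 + b2) = 0 := by
            intro j hj
            rw [map_add, hb1 j hj, hb2 j hj, add_zero]
          obtain ⟨a', ha', hda'⟩ := ihN (x - dH _ (b1 + b2)) (by
              rw [map_sub, ← hpowd, map_add, hb1', hb2', map_add, pow_one, hdU, hdy', map_zero,
                zero_add, pow_zero, Module.End.one_apply, hya, sub_self]) (by
              intro j hj
              rw [map_sub, hx j hj, ← hdD, hbb j hj, map_zero, sub_zero]) (by
              rw [map_sub, hdx, hdH2, sub_zero]) (by
              obtain ⟨b, hb⟩ := hb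
              refine ⟨b - ε _ (b1 + b2), ?_⟩
              convert Submodule.sub_mem _ hb (hεd' (i + 1) _ _ hbb) using 1
              simp only [map_sub]
              abel)
          refine ⟨a' + (b1 + b2), ?_, ?_⟩
          · intro j hj
            rw [map_add, ha' j hj, hbb j hj, add_zero]
          · rw [map_add, hda']
            abel
      intro x
      obtain ⟨N, hN⟩ := hnil _ i x
      exact main N x hN
    · intro q z hz
      obtain ⟨c, hc, b, hb⟩ := hsurj i q z hz
      obtain ⟨x, hx, hdx, b', hb'⟩ := ihS q c hc
      refine ⟨x, fun j hj => hx j (by omega), hdx, b + b', ?_⟩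
      convert Submodule.add_mem _ hb (hSle i (i + 1) _ (Nat.le_succ _) hb') using 1
      simp only [map_add]
      abel

theorem pderiv_nil {A : Type*} [CommRing A] {r : ℕ} (j : Fin r)
    (p : MvPolynomial (Fin r) A) :
    ∃ N : ℕ, (((pderiv j).toLinearMap : MvPolynomial (Fin r) A →ₗ[A] _) ^ N) p = 0 := by
  induction p using MvPolynomial.monomial_add_induction_on with
  | C a => exact ⟨1, by simp⟩
  | monomial_add s a p _ _ ih =>
    obtain ⟨N, hN⟩ := ih
    have hm : ∀ (n : ℕ) (s : Fin r →₀ ℕ) (a : A), s j < n →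
        (((pderiv j).toLinearMap : MvPolynomial (Fin r) A →ₗ[A] _) ^ n) (monomial s a) = 0 := by
      intro n
      induction n with
      | zero => intro s a h; omega
      | succ n ih =>
        intro s a h
        rw [pow_succ, Module.End.mul_apply, Derivation.coeFn_coe, pderiv_monomial]
        by_cases hs : s j = 0
        · simp [hs]
        · apply ih
          simp
          omega
    refine ⟨(s j + 1) + N, ?_⟩
    rw [map_add]
    have h1 := hm (s j + 1) s a (Nat.lt_succ_self _)
    nth_rewrite 1 [add_comm (s j + 1) N]
    rw [pow_add _ N, pow_add _ _ N, Module.End.mul_apply, Module.End.mul_apply, h1, hN]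
    simp

/-- Coefficients of an element of `A[u] ⊗ N`. -/
theorem exists_coeffEquiv (A : Type*) [CommRing A] (r : ℕ) (N : Type*) [AddCommGroup N]
    [Module A N] : ∃ T : (MvPolynomial (Fin r) A ⊗[A] N) ≃ₗ[A] ((Fin r →₀ ℕ) →₀ N),
      ∀ p n m, T (p ⊗ₜ n) m = coeff m p • n := by
  refine ⟨(TensorProduct.congr (MvPolynomial.basisMonomials (Fin r) A).repr
    (LinearEquiv.refl A N)).trans (TensorProduct.finsuppScalarLeft A N _), ?_⟩
  intro p n m
  rw [LinearEquiv.trans_apply, TensorProduct.congr_tmul,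
    TensorProduct.finsuppScalarLeft_apply_tmul_apply]
  rfl

end HirschAux

/-- Let `A` be a commutative `ℚ`-algebra, `r ≥ 1`, and `C•` a complex of `A`-modules
which is a dg-module with fixed degree-one cocycles `ω_1, …, ω_r` acting via `mulω`.
Let `C_i• = C•/(ω_1,…,ω_i)∧` be the iterated quotients (realized via the submodules
`Si i q = (ω_1 ∧ C^q) + ⋯ + (ω_i ∧ C^q) ⊆ C^{q+1}`), with `C_0• = C•`.  Suppose that
for each `i` and all `q`, wedging with `ω_{i+1}` gives short exact sequences
`0 → H^{q-1}(C_{i+1}•) → H^q(C_i•) → H^q(C_{i+1}•) → 0`.  Then the projection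
(`u_i ↦ 0`, `C• → C_r•`) from the `r`-variable Hirsch extension
`Sym_A(A^r) ⊗_A C• = A[u_1,…,u_r] ⊗_A C•` (with `d(u_i) = ω_i`) to
`C_r• = C•/(ω_1,…,ω_r)∧` is a quasi-isomorphism. -/
theorem multivariable_hirsch_projection_quasiIso
    (A : Type*) [CommRing A] [Algebra ℚ A] (r : ℕ) (hr : 0 < r)
    (C : ℤ → Type*) [∀ q, AddCommGroup (C q)] [∀ q, Module A (C q)]
    (d : ∀ q : ℤ, C q →ₗ[A] C (q + 1))
    (hd2 : ∀ q (c : C q), d (q + 1) (d q c) = 0)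
    (mulω : Fin r → ∀ q : ℤ, C q →ₗ[A] C (q + 1))
    (hLeib : ∀ k q (c : C q), d (q + 1) (mulω k q c) = - mulω k (q + 1) (d q c))
    (hanti : ∀ k l q (c : C q),
      mulω k (q + 1) (mulω l q c) = - mulω l (q + 1) (mulω k q c))
    -- the submodules `Si i q = (ω_1 ∧ C^q) + ⋯ + (ω_i ∧ C^q) ⊆ C^{q+1}`:
    (Si : ℕ → ∀ q : ℤ, Submodule A (C (q + 1)))
    (hSi : ∀ i q, Si i q =
      ⨆ j : Fin r, ⨆ _ : (j : ℕ) < i, LinearMap.range (mulω j q))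
    -- the differentials of the quotient complexes `C_i•`:
    (dN : ∀ (i : ℕ) (q : ℤ),
      (C (q + 1) ⧸ Si i q) →ₗ[A] (C (q + 1 + 1) ⧸ Si i (q + 1)))
    (hdN : ∀ i q (c : C (q + 1)),
      dN i q (Submodule.Quotient.mk c) = Submodule.Quotient.mk (d (q + 1) c))
    -- the short exact sequences `0 → H^{q-1}(C_{i+1}) → H^q(C_i) → H^q(C_{i+1}) → 0`:
    (hinj : ∀ (i : Fin r) (q : ℤ) (c : C (q + 1)),
      d (q + 1) c ∈ Si (i + 1) (q + 1) →
      (∃ b : C (q + 1), mulω i (q + 1) c - d (q + 1) b ∈ Si i (q + 1)) →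
      ∃ a : C q, c - d q a ∈ Si (i + 1) q)
    (hmid : ∀ (i : Fin r) (q : ℤ) (z : C (q + 1 + 1)),
      d (q + 1 + 1) z ∈ Si i (q + 1 + 1) →
      (∃ b : C (q + 1), z - d (q + 1) b ∈ Si (i + 1) (q + 1)) →
      ∃ c : C (q + 1), d (q + 1) c ∈ Si (i + 1) (q + 1) ∧
        ∃ a : C (q + 1), z - mulω i (q + 1) c - d (q + 1) a ∈ Si i (q + 1))
    (hsurj : ∀ (i : Fin r) (q : ℤ) (z : C (q + 1)),
      d (q + 1) z ∈ Si (i + 1) (q + 1) →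
      ∃ c : C (q + 1), d (q + 1) c ∈ Si i (q + 1) ∧
        ∃ b : C q, z - c - d q b ∈ Si (i + 1) q)
    -- the Hirsch extension differential on `A[u_1,…,u_r] ⊗ C•`:
    (dH : ∀ q : ℤ,
      (MvPolynomial (Fin r) A ⊗[A] C q) →ₗ[A] (MvPolynomial (Fin r) A ⊗[A] C (q + 1)))
    (hdH : ∀ q, dH q =
      (∑ k : Fin r, TensorProduct.map (pderiv k).toLinearMap (mulω k q))
        + TensorProduct.map LinearMap.id (d q))
    -- the projection `A[u_1,…,u_r] ⊗ C• → C_r•`: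
    (P : ∀ q : ℤ, (MvPolynomial (Fin r) A ⊗[A] C (q + 1)) →ₗ[A] (C (q + 1) ⧸ Si r q))
    (hP : ∀ q (p : MvPolynomial (Fin r) A) (c : C (q + 1)),
      P q (p ⊗ₜ[A] c) = constantCoeff p • Submodule.Quotient.mk c) :
    -- conclusion: `P` is a quasi-isomorphism
    ∀ q : ℤ,
      (∀ x : MvPolynomial (Fin r) A ⊗[A] C (q + 1 + 1), dH (q + 1 + 1) x = 0 →
        (∃ b : C (q + 1) ⧸ Si r q, dN r q b = P (q + 1) x) →
        ∃ a : MvPolynomial (Fin r) A ⊗[A] C (q + 1), dH (q + 1) a = x) ∧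
      (∀ z : C (q + 1 + 1) ⧸ Si r (q + 1), dN r (q + 1) z = 0 →
        ∃ x : MvPolynomial (Fin r) A ⊗[A] C (q + 1 + 1), dH (q + 1 + 1) x = 0 ∧
          ∃ b : C (q + 1) ⧸ Si r q, z - P (q + 1) x = dN r q b) := by
  let D : ∀ q : ℤ, Fin r → (MvPolynomial (Fin r) A ⊗[A] C q) →ₗ[A] (MvPolynomial (Fin r) A ⊗[A] C q) :=
    fun q k => TensorProduct.map (pderiv k).toLinearMap LinearMap.id
  let U : ∀ q : ℤ, Fin r → (MvPolynomial (Fin r) A ⊗[A] C q) →ₗ[A] (MvPolynomial (Fin r) A ⊗[A] C q) :=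
    fun q k => TensorProduct.map (LinearMap.mulLeft A (X k)) LinearMap.id
  let W : Fin r → ∀ q : ℤ, (MvPolynomial (Fin r) A ⊗[A] C q) →ₗ[A] (MvPolynomial (Fin r) A ⊗[A] C (q + 1)) :=
    fun k q => TensorProduct.map LinearMap.id (mulω k q)
  let ε : ∀ q : ℤ, (MvPolynomial (Fin r) A ⊗[A] C q) →ₗ[A] C q :=
    fun q => (TensorProduct.lid A (C q)).toLinearMap ∘ₗ
      TensorProduct.map (MvPolynomial.lcoeff A 0) LinearMap.id
  let ι : ∀ q : ℤ, C q →ₗ[A] (MvPolynomial (Fin r) A ⊗[A] C q) :=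
    fun q => TensorProduct.mk A _ _ 1
  have hDt : ∀ q k p c, D q k (p ⊗ₜ c) = (pderiv k p) ⊗ₜ c := fun _ _ _ _ => rfl
  have hUt : ∀ q k p c, U q k (p ⊗ₜ c) = (X k * p) ⊗ₜ c := fun _ _ _ _ => rfl
  have hWt : ∀ q k p c, W k q (p ⊗ₜ c) = p ⊗ₜ mulω k q c := fun _ _ _ _ => rfl
  have hεt : ∀ q p c, ε q (p ⊗ₜ c) = coeff 0 p • c := fun _ _ _ => rfl
  have hιt : ∀ q c, ι q c = 1 ⊗ₜ c := fun _ _ => rfl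
  have hdt : ∀ q p c, dH q (p ⊗ₜ c) =
      (∑ k : Fin r, (pderiv k p) ⊗ₜ mulω k q c) + p ⊗ₜ d q c := by
    intro q p c
    rw [hdH]
    simp [LinearMap.sum_apply]
  clear_value D U W ε ι
  have hpp : ∀ (j k : Fin r) (p : MvPolynomial (Fin r) A),
      pderiv j (pderiv k p) = pderiv k (pderiv j p) := by
    intro j k p
    have h : ⁅(pderiv j : Derivation A (MvPolynomial (Fin r) A) (MvPolynomial (Fin r) A)),
         (pderiv k : Derivation A (MvPolynomial (Fin r) A) (MvPolynomial (Fin r) A))⁆ = 0 := by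
      apply MvPolynomial.derivation_ext
      intro i
      rw [Derivation.commutator_apply]
      simp [pderiv_X, Pi.single_apply, apply_ite]
    have h2 := congrArg (fun D => D p) h
    simp only [Derivation.commutator_apply, Derivation.zero_apply] at h2
    exact sub_eq_zero.mp h2
  have hεP : ∀ q x, P q x = Submodule.Quotient.mk (ε (q + 1) x) := by
    intro q x
    induction x with
    | zero => simp
    | tmul p c => rw [hP, hεt, constantCoeff_eq, Submodule.Quotient.mk_smul]
    | add x y hx hy => simp [hx, hy]
  have hDD : ∀ q j k x, D q j (D q k x) = D q k (D q j x) := by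
    intro q j k x
    induction x with
    | zero => simp
    | tmul p c => simp only [hDt, hpp j k]
    | add x y hx hy => simp only [map_add, hx, hy]
  have hdD : ∀ q j x, dH q (D q j x) = D (q + 1) j (dH q x) := by
    intro q j x
    induction x with
    | zero => simp
    | tmul p c => simp only [hDt, hdt, map_add, map_sum, hpp j]
    | add x y hx hy => simp only [map_add, hx, hy]
  have hdU : ∀ q j x, dH q (U q j x) = U (q + 1) j (dH q x) + W j q x := by
    intro q j x
    induction x with
    | zero => simp
    | tmul p c =>
      simp only [hUt, hdt, hWt, map_add, map_sum]
      have : ∀ k, pderiv k (X j * p) = X j * pderiv k p + if j = k then p else 0 := by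
        intro k
        rw [Derivation.leibniz, pderiv_X]
        by_cases h : j = k
        · subst h; simp
        · simp [h]
      simp only [this, TensorProduct.add_tmul, Finset.sum_add_distrib, TensorProduct.ite_tmul]
      simp
      abel
    | add x y hx hy => simp only [map_add, hx, hy]; abel
  have hdH2 : ∀ q x, dH (q + 1) (dH q x) = 0 := by
    intro q x
    induction x with
    | zero => simp
    | tmul p c =>
      simp only [hdt, map_add, map_sum, hd2, hLeib, TensorProduct.tmul_zero, add_zero,
        TensorProduct.tmul_neg, Finset.sum_add_distrib, Finset.sum_neg_distrib]
      have hz : ∑ k : Fin r, ∑ l : Fin r,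
          (pderiv l (pderiv k p)) ⊗ₜ[A] mulω l (q + 1) (mulω k q c) = 0 := by
        set S := ∑ k : Fin r, ∑ l : Fin r,
          (pderiv l (pderiv k p)) ⊗ₜ[A] mulω l (q + 1) (mulω k q c) with hS
        have h1 : S = -S := by
          conv_lhs => rw [hS, Finset.sum_comm]
          rw [hS, ← Finset.sum_neg_distrib]
          refine Finset.sum_congr rfl fun k _ => ?_
          rw [← Finset.sum_neg_distrib]
          refine Finset.sum_congr rfl fun l _ => ?_
          rw [hanti k l, hpp k l, TensorProduct.tmul_neg]
        apply HirschAux.smul_cancel (A := A) 1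
        rw [eq_neg_iff_add_eq_zero] at h1
        push_cast
        rw [← h1]
        module
      rw [hz]
      abel
    | add x y hx hy => simp only [map_add, hx, hy, add_zero]
  have hεd : ∀ q x, ε (q + 1) (dH q x) = d q (ε q x) + ∑ k, mulω k q (ε q (D q k x)) := by
    intro q x
    induction x with
    | zero => simp
    | tmul p c => simp only [hDt, hdt, hεt, map_add, map_sum, map_smul]; abel
    | add x y hx hy => simp only [map_add, hx, hy, Finset.sum_add_distrib]; abel
  have hker : ∀ q x, (∀ j, D q j x = 0) → x = ι q (ε q x) := by
    intro q x hx
    obtain ⟨T, hT⟩ := HirschAux.exists_coeffEquiv A r (C q)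
    have hc : ∀ (j : Fin r) (m : Fin r →₀ ℕ) (x : MvPolynomial (Fin r) A ⊗[A] C q),
        T (D q j x) m =
          ((m j + 1 : ℕ) : A) • T x (m + Finsupp.single j 1) := by
      intro j m x
      induction x with
      | zero => simp
      | tmul p c =>
        rw [hDt, hT, hT, smul_smul,
          coeff_pderiv]
        push_cast
        rw [mul_comm]
      | add x y hx hy => simp only [map_add, Finsupp.add_apply, hx, hy, smul_add]
    have h0 : ∀ x, T x 0 = ε q x := by
      intro x
      induction x with
      | zero => simp
      | tmul p c => rw [hT, hεt]
      | add x y hx hy => simp only [map_add, Finsupp.add_apply, hx, hy]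
    apply T.injective
    ext m
    rw [hιt, hT, coeff_one]
    by_cases hm : m = 0
    · subst hm
      simp [h0]
    · obtain ⟨j, hj⟩ : ∃ j, m j ≠ 0 := by
        by_contra! h
        exact hm (Finsupp.ext h)
      have h1 := hc j (m - Finsupp.single j 1) x
      rw [hx j, tsub_add_cancel_of_le (by simpa using Nat.one_le_iff_ne_zero.mpr hj)] at h1
      rw [if_neg (Ne.symm hm), zero_smul]
      apply HirschAux.smul_cancel (A := A) _ _ (h1.symm.trans _)
      simp
  have hnil : ∀ q j x, ∃ N : ℕ, (D q j ^ N) x = 0 := by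
    intro q j x
    induction x with
    | zero => exact ⟨0, by simp⟩
    | tmul p c =>
      obtain ⟨N, hN⟩ := HirschAux.pderiv_nil j p
      refine ⟨N, ?_⟩
      have : ∀ N : ℕ, (D q j ^ N) (p ⊗ₜ c) =
          ((((pderiv j).toLinearMap : MvPolynomial (Fin r) A →ₗ[A] _) ^ N) p) ⊗ₜ c := by
        intro N
        induction N with
        | zero => simp
        | succ N ih =>
          rw [pow_succ', pow_succ', Module.End.mul_apply, Module.End.mul_apply, ih, hDt]
          rfl
      rw [this, hN, TensorProduct.zero_tmul]
    | add x y hx hy =>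
      obtain ⟨N, hN⟩ := hx
      obtain ⟨M, hM⟩ := hy
      refine ⟨N + M, ?_⟩
      rw [map_add]
      nth_rewrite 1 [add_comm N M]
      rw [pow_add, pow_add, Module.End.mul_apply, Module.End.mul_apply, hN, hM]
      simp
  obtain ⟨hI, hS⟩ := HirschAux.main_aux A r C d mulω hLeib hanti Si hSi hinj hmid hsurj
    (fun q => MvPolynomial (Fin r) A ⊗[A] C q) dH hdH2 D U W ε ι hDD
    (by
      intro q j x
      induction x with
      | zero => simp
      | tmul p c =>
        simp only [hDt, hUt, Derivation.leibniz, pderiv_X_self, TensorProduct.add_tmul]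
        simp
      | add x y hx hy => simp only [map_add, hx, hy]; abel)
    (by
      intro q j k x hjk
      induction x with
      | zero => simp
      | tmul p c =>
        simp only [hDt, hUt, Derivation.leibniz, pderiv_X_of_ne hjk.symm]
        simp
      | add x y hx hy => simp only [map_add, hx, hy])
    hdD
    (by
      intro q j k x
      induction x with
      | zero => simp
      | tmul p c => simp only [hDt, hWt]
      | add x y hx hy => simp only [map_add, hx, hy])
    hdU
    (by
      intro q j x
      induction x with
      | zero => simp
      | tmul p c => simp only [hεt, hWt, map_smul]
      | add x y hx hy => simp only [map_add, hx, hy])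
    hεd
    (by intro q j c; rw [hιt, hDt]; simp)
    (by intro q c; rw [hιt, hdt, hιt]; simp)
    (by intro q c; rw [hιt, hεt]; simp)
    hker hnil r le_rfl
  intro q
  refine ⟨?_, ?_⟩
  · rintro x hx ⟨b, hb⟩
    obtain ⟨b, rfl⟩ := Submodule.Quotient.mk_surjective _ b
    rw [hdN, hεP, eq_comm, Submodule.Quotient.eq] at hb
    obtain ⟨a, -, ha⟩ := hI q x (fun j hj => absurd j.2 (by omega)) hx ⟨b, hb⟩
    exact ⟨a, ha⟩
  · intro z hz
    obtain ⟨z, rfl⟩ := Submodule.Quotient.mk_surjective _ z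
    rw [hdN, Submodule.Quotient.mk_eq_zero] at hz
    obtain ⟨x, -, hx, b, hb⟩ := hS (q + 1) z hz
    refine ⟨x, hx, Submodule.Quotient.mk b, ?_⟩
    rw [hdN, hεP, ← Submodule.Quotient.mk_sub, Submodule.Quotient.eq]
    exact hb
end
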